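/- Suppose (G_n) satisfies Assumption 1 and set Γ_n = c_0 · T_mix(G_n) · log|V_n| for a sufficiently large universal constant c_0. Then, as n → ∞, Σ_{x ≠ y, z} ( P_{x,z}[ τ_1(y) < τ_2(y) ≤ Γ_n ] − P_{x,z}[ τ_2(y) < τ_1(y) ≤ Γ_n ] ) · π̃(z;x,y) = o( T_mix(G_n)^2 ). -/

import Mathlib

open MeasureTheory ProbabilityTheory Filter

attribute [local instance] Classical.propDecidable

noncomputable section

namespace RWPaint

variable {V : Type*} [Fintype V]

/-- The degree of a vertex. -/
def deg (G : SimpleGraph V) (x : V) : ℕ := (Finset.univ.filter fun y => G.Adj x y).card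

/-- One-step transition kernel of the lazy random walk on a finite graph:
holding probability `1/2`, otherwise a uniformly chosen neighbour. -/
def K (G : SimpleGraph V) (x y : V) : ℝ :=
  if x = y then (if deg G x = 0 then 1 else 1 / 2)
  else if G.Adj x y then 1 / (2 * (deg G x : ℝ)) else 0

/-- The `t`-step transition kernel. -/
def Kpow (G : SimpleGraph V) : ℕ → V → V → ℝ
  | 0 => fun x y => if x = y then 1 else 0
  | t + 1 => fun x y => ∑ z, Kpow G t x z * K G z y

/-- The uniform (stationary) probability of a single vertex. -/
def unif (V : Type*) [Fintype V] : ℝ := (Fintype.card V : ℝ)⁻¹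

/-- The uniform mixing time. -/
def Tmix (G : SimpleGraph V) : ℕ :=
  sInf {t : ℕ | ∀ x y : V, |Kpow G t x y / unif V - 1| ≤ 1 / 4}

/-- The Green's function `g(x,y) = ∑_{t=0}^{Tmix} p^t(x,y)`. -/
def green (G : SimpleGraph V) (x y : V) : ℝ :=
  ∑ t ∈ Finset.range (Tmix G + 1), Kpow G t x y

/-- The kernel killed on (entering) the set `S`. -/
def Kkill (G : SimpleGraph V) (S : Finset V) (x y : V) : ℝ :=
  if y ∈ S then 0 else K G x y

/-- Powers of the killed kernel. -/
def KkillPow (G : SimpleGraph V) (S : Finset V) : ℕ → V → V → ℝ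
  | 0 => fun x y => if x = y then 1 else 0
  | t + 1 => fun x y => ∑ z, KkillPow G S t x z * Kkill G S z y

/-- `P_x[τ(S) ≤ T]`, the probability that the lazy walk started at `x` visits `S`
by time `T`. -/
def hitBy (G : SimpleGraph V) (S : Finset V) (x : V) (T : ℕ) : ℝ :=
  if x ∈ S then 1 else 1 - ∑ z, KkillPow G S T x z

/-- `f_{n,c}(x,y) = P_x[τ(y) ≤ c T_mix]`. -/
def fnc (G : SimpleGraph V) (c : ℝ) (x y : V) : ℝ :=
  hitBy G {y} x ⌊c * (Tmix G : ℝ)⌋₊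

/-- `f̄_{n,c} = ∑_y f_{n,c}(x,y) π(y)` (averaged also over `x`; by vertex
transitivity this agrees with the value for any fixed `x`). -/
def fbar (G : SimpleGraph V) (c : ℝ) : ℝ :=
  (∑ x : V, ∑ y : V, fnc G c x y) / (Fintype.card V : ℝ) ^ 2

/-- `F_{n,c} = ∑_{x,y} (f_{n,c}(x,y) - f̄_{n,c})^2`. -/
def Fquad (G : SimpleGraph V) (c : ℝ) : ℝ :=
  ∑ x : V, ∑ y : V, (fnc G c x y - fbar G c) ^ 2

/-- `Γ_n = c₀ T_mix log |V|`. -/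
def gammaTime (G : SimpleGraph V) (c₀ : ℝ) : ℕ :=
  ⌊c₀ * (Tmix G : ℝ) * Real.log (Fintype.card V)⌋₊

/-- `P_x[X_t = z | τ(y) ≥ t]` as a combinatorial formula (meaningful for
`x ≠ y` and `t ≥ 1`). -/
def condAtProb (G : SimpleGraph V) (y x z : V) (t : ℕ) : ℝ :=
  (∑ w, KkillPow G {y} (t - 1) x w * K G w z) / (∑ w, KkillPow G {y} (t - 1) x w)

/-- `∑_{t=0}^{c T_mix} p^t(x,y)`. -/
def greenC (G : SimpleGraph V) (c : ℝ) (x y : V) : ℝ :=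
  ∑ t ∈ Finset.range (⌊c * (Tmix G : ℝ)⌋₊ + 1), Kpow G t x y

/-- A graph is vertex transitive if its automorphism group acts transitively. -/
def IsVertexTransitive (G : SimpleGraph V) : Prop :=
  ∀ x y : V, ∃ e : G ≃g G, e x = y

/-- The probability of a trajectory prefix for the lazy walk with initial
distribution `init`. -/
def walkP (G : SimpleGraph V) (init : V → ℝ) (n : ℕ) (v : ℕ → V) : ℝ :=
  init (v 0) * ∏ i ∈ Finset.range n, K G (v i) (v (i + 1))

/-- Point mass initial distribution. -/
def delta (x : V) : V → ℝ := fun y => if y = x then 1 else 0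

/-- Uniform initial distribution. -/
def uinit (V : Type*) [Fintype V] : V → ℝ := fun _ => (Fintype.card V : ℝ)⁻¹

/-- `X₁, X₂` are independent lazy random walks on `G` with initial
distributions `init₁, init₂`, defined on the probability space `(Ω, P)`:
all finite-dimensional distributions factorize as products of trajectory-prefix
probabilities. -/
structure IsWalkPair {Ω : Type*} [MeasurableSpace Ω] (G : SimpleGraph V) (P : Measure Ω)
    (X₁ X₂ : ℕ → Ω → V) (init₁ init₂ : V → ℝ) : Prop where
  meas₁ : ∀ (t : ℕ) (x : V), MeasurableSet {ω | X₁ t ω = x}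
  meas₂ : ∀ (t : ℕ) (x : V), MeasurableSet {ω | X₂ t ω = x}
  law : ∀ (n : ℕ) (v w : ℕ → V),
    (P {ω | (∀ i ≤ n, X₁ i ω = v i) ∧ ∀ i ≤ n, X₂ i ω = w i}).toReal
      = walkP G init₁ n v * walkP G init₂ n w

/-- `X₁, X₂` are independent stationary lazy random walks on `G`, together with
a family `ξ` of independent fair coins (one per vertex, used to break ties),
all defined on the probability space `(Ω, P)`. -/
structure IsPaintSetup {Ω : Type*} [MeasurableSpace Ω] (G : SimpleGraph V) (P : Measure Ω)
    (X₁ X₂ : ℕ → Ω → V) (ξ : V → Ω → Bool) : Prop where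
  meas₁ : ∀ (t : ℕ) (x : V), MeasurableSet {ω | X₁ t ω = x}
  meas₂ : ∀ (t : ℕ) (x : V), MeasurableSet {ω | X₂ t ω = x}
  measξ : ∀ x : V, MeasurableSet {ω | ξ x ω = true}
  law : ∀ (n : ℕ) (v w : ℕ → V) (b : V → Bool),
    (P {ω | ((∀ i ≤ n, X₁ i ω = v i) ∧ ∀ i ≤ n, X₂ i ω = w i) ∧ ∀ x, ξ x ω = b x}).toReal
      = walkP G (uinit V) n v * walkP G (uinit V) n w * (1 / 2) ^ Fintype.card V

/-- The hitting time `τ(x)` of a vertex `x` (with value `⊤` if `x` is never visited). -/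
def hitTime {Ω : Type*} (X : ℕ → Ω → V) (x : V) (ω : Ω) : ℕ∞ :=
  ⨅ (s : ℕ) (_ : X s ω = x), (s : ℕ∞)

/-- `τ(x,y) = τ(x) ⊓ τ(y)`. -/
def hitTime2 {Ω : Type*} (X : ℕ → Ω → V) (x y : V) (ω : Ω) : ℕ∞ :=
  min (hitTime X x ω) (hitTime X y ω)

/-- `|𝒜₁|`: the number of vertices first visited by `X₁` (ties broken by the coins `ξ`). -/
def paintedCount {Ω : Type*} (X₁ X₂ : ℕ → Ω → V) (ξ : V → Ω → Bool) (ω : Ω) : ℕ :=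
  Nat.card {x : V // hitTime X₁ x ω < hitTime X₂ x ω ∨
    (hitTime X₁ x ω = hitTime X₂ x ω ∧ ξ x ω = true)}

/-- The event `H(x,y) = {τ₁(x) < min(τ₁(y), τ₂(x), τ₂(y))}`. -/
def Hevent {Ω : Type*} (X₁ X₂ : ℕ → Ω → V) (x y : V) : Set Ω :=
  {ω | hitTime X₁ x ω < min (hitTime X₁ y ω) (min (hitTime X₂ x ω) (hitTime X₂ y ω))}

/-- `Y₂ = X₂(τ₁(x,y))`. -/
def Ytwo {Ω : Type*} (X₁ X₂ : ℕ → Ω → V) (x y : V) (ω : Ω) : V :=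
  X₂ (hitTime2 X₁ x y ω).toNat ω

/-- `π̃(z;x,y) = P[X₂(τ₁(x,y)) = z | H(x,y)]`. -/
def pitilde {Ω : Type*} [MeasurableSpace Ω] (P : Measure Ω) (X₁ X₂ : ℕ → Ω → V) (x y z : V) : ℝ :=
  (P (Hevent X₁ X₂ x y ∩ {ω | Ytwo X₁ X₂ x y ω = z})).toReal
    / (P (Hevent X₁ X₂ x y)).toReal

/-- The event `A(x,y) = {τ₁(x,y) ≥ τ₂(x,y) > τ₁(x,y) - Γ, τ₁(x) < τ₁(y)}`. -/
def Aevent {Ω : Type*} (X₁ X₂ : ℕ → Ω → V) (x y : V) (Γ : ℕ) : Set Ω :=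
  {ω | hitTime2 X₂ x y ω ≤ hitTime2 X₁ x y ω ∧
    hitTime2 X₁ x y ω - (Γ : ℕ∞) < hitTime2 X₂ x y ω ∧
    hitTime X₁ x ω < hitTime X₁ y ω}

/-- Conditional probability `P[A | B]`. -/
def condGiven {Ω : Type*} [MeasurableSpace Ω] (P : Measure Ω) (A B : Set Ω) : ℝ :=
  (P (A ∩ B)).toReal / (P B).toReal

/-- Assumption 1 of the paper. -/
structure Assumption1 (V : ℕ → Type*) [∀ n, Fintype (V n)]
    (G : ∀ n, SimpleGraph (V n)) : Prop where
  conn : ∀ n, (G n).Connected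
  vt : ∀ n, IsVertexTransitive (G n)
  card_top : Tendsto (fun n => Fintype.card (V n)) atTop atTop
  tmix_small : Tendsto (fun n =>
    (Tmix (G n) : ℝ) * (Real.log (Fintype.card (V n))) ^ 2 / (Fintype.card (V n) : ℝ))
    atTop (nhds 0)
  tmix_top : Tendsto (fun n => Tmix (G n)) atTop atTop
  green_sq_small : ∃ ε : ℕ → ℝ, Tendsto ε atTop (nhds 0) ∧
    ∀ n, ∀ x : V n, ∑ y ∈ Finset.univ.erase x, (green (G n) x y) ^ 2
      ≤ ε n * (Tmix (G n) : ℝ) / Real.log (Fintype.card (V n))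
  hit_miss : ∃ ρ : ℝ, ρ < 1 ∧ ∀ n, ∀ x y z : V n, x ≠ y → x ≠ z → y ≠ z →
    hitBy (G n) {y, z} x (Tmix (G n)) ≤ ρ

/-- The discrete torus `ℤ_n^d`. -/
def torus (d n : ℕ) : SimpleGraph (Fin d → ZMod n) where
  Adj x y := x ≠ y ∧ ∃ i, y - x = Pi.single i 1 ∨ x - y = Pi.single i 1
  symm := by
    constructor
    rintro x y ⟨hne, i, h | h⟩
    · exact ⟨hne.symm, i, Or.inr h⟩
    · exact ⟨hne.symm, i, Or.inl h⟩
  loopless := ⟨fun x h => h.1 rfl⟩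

/-- The hypercube `ℤ_2^n`. -/
def hypercube (n : ℕ) : SimpleGraph (Fin n → Bool) where
  Adj x y := x ≠ y ∧ ∃ i, ∀ j, j ≠ i → x j = y j
  symm := by
    constructor
    rintro x y ⟨hne, i, h⟩
    exact ⟨hne.symm, i, fun j hj => (h j hj).symm⟩
  loopless := ⟨fun x h => h.1 rfl⟩

/-- The Cayley graph of the symmetric group `S_n` generated by the transpositions. -/
def transpositionGraph (n : ℕ) : SimpleGraph (Equiv.Perm (Fin n)) where
  Adj σ τ := (σ * τ⁻¹).IsSwap
  symm := by
    constructor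
    rintro σ τ ⟨a, b, hab, h⟩
    exact ⟨a, b, hab, by rw [show τ * σ⁻¹ = (σ * τ⁻¹)⁻¹ by group, h, Equiv.swap_inv]⟩
  loopless := by
    constructor
    intro σ h
    obtain ⟨a, b, hab, h⟩ := h
    rw [mul_inv_cancel] at h
    exact hab (by simpa [Equiv.swap_apply_left] using Equiv.ext_iff.mp h a)

/-- One-step kernel of the lazy simple random walk on `ℤ^d`. -/
def KZ (d : ℕ) (x y : Fin d → ℤ) : ℝ :=
  if x = y then 1 / 2
  else if ∃ i, y - x = Pi.single i 1 ∨ x - y = Pi.single i 1 then 1 / (4 * d) else 0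

/-- `t`-step kernel of the lazy simple random walk on `ℤ^d`. -/
def KZpow (d : ℕ) : ℕ → (Fin d → ℤ) → (Fin d → ℤ) → ℝ
  | 0 => fun x y => if x = y then 1 else 0
  | t + 1 => fun x y => ∑' z, KZpow d t x z * KZ d z y

/-- The Green's function `G(x; ℤ^d) = ∑_{t=0}^∞ p^t(0,x)` of the lazy walk on `ℤ^d`. -/
def greenZ (d : ℕ) (x : Fin d → ℤ) : ℝ := ∑' t : ℕ, KZpow d t 0 x

/-- `α_d` for `d ≥ 5`. -/
def alphaHigh (d : ℕ) : ℝ := (∑' y : Fin d → ℤ, (greenZ d y) ^ 2) / (greenZ d 0) ^ 2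

/-- The normalization `h_d(n)`. -/
def hfun (d n : ℕ) : ℝ :=
  if d = 3 then (n : ℝ) ^ 4
  else if d = 4 then (n : ℝ) ^ 4 * Real.log n
  else (n : ℝ) ^ d

/-- Matrix powers of an abstract kernel. -/
def mpow (p : V → V → ℝ) : ℕ → V → V → ℝ
  | 0 => fun x y => if x = y then 1 else 0
  | t + 1 => fun x y => ∑ z, mpow p t x z * p z y

/-- Total variation distance between two (probability) vectors. -/
def tvDist (μ ν : V → ℝ) : ℝ := (1 / 2) * ∑ x, |μ x - ν x|


set_option linter.unusedSectionVars false

/-! ### Part A: matrix analysis -/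

structure Good (A : Matrix V V ℝ) (T : ℕ) : Prop where
  nonneg : ∀ x y, 0 ≤ A x y
  symm : ∀ x y, A x y = A y x
  row : ∀ x, ∑ y, A x y = 1
  mix : ∀ x y, |(A ^ T) x y * (Fintype.card V : ℝ) - 1| ≤ 1 / 4
  one_le : 1 ≤ T
  card_pos : 0 < (Fintype.card V : ℝ)

def avg (f : V → ℝ) : ℝ := (∑ z, f z) / (Fintype.card V : ℝ)

lemma avg_mono {f g : V → ℝ} (h : ∀ z, f z ≤ g z) : avg f ≤ avg g := by
  unfold avg
  exact div_le_div_of_nonneg_right (Finset.sum_le_sum fun z _ => h z) (by positivity)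

lemma avg_nonneg {f : V → ℝ} (h : ∀ z, 0 ≤ f z) : 0 ≤ avg f := by
  unfold avg
  exact div_nonneg (Finset.sum_nonneg fun z _ => h z) (by positivity)

lemma avg_sub (f g : V → ℝ) : avg (fun z => f z - g z) = avg f - avg g := by
  unfold avg
  rw [Finset.sum_sub_distrib, sub_div]

lemma avg_mul (c : ℝ) (f : V → ℝ) : avg (fun z => c * f z) = c * avg f := by
  unfold avg
  rw [← Finset.mul_sum, mul_div_assoc]

namespace Good

variable {A : Matrix V V ℝ} {T : ℕ}

lemma avg_const (h : Good A T) (c : ℝ) : avg (fun _ : V => c) = c := by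
  have := h.card_pos
  unfold avg
  rw [Finset.sum_const, Finset.card_univ, nsmul_eq_mul]
  field_simp

lemma pow_nonneg (h : Good A T) (k : ℕ) : ∀ x y, 0 ≤ (A ^ k) x y := by
  induction k with
  | zero => intro x y; rw [pow_zero, Matrix.one_apply]; split_ifs <;> norm_num
  | succ k ih =>
    intro x y
    rw [pow_succ, Matrix.mul_apply]
    exact Finset.sum_nonneg fun z _ => mul_nonneg (ih x z) (h.nonneg z y)

lemma pow_symm (h : Good A T) (k : ℕ) (x y : V) : (A ^ k) x y = (A ^ k) y x := by
  have hA : A.transpose = A := by ext i j; exact h.symm j i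
  have : (A ^ k).transpose = A ^ k := by rw [Matrix.transpose_pow, hA]
  conv_lhs => rw [← this]
  rfl

lemma pow_row (h : Good A T) (k : ℕ) : ∀ x, ∑ y, (A ^ k) x y = 1 := by
  induction k with
  | zero => intro x; simp [Matrix.one_apply]
  | succ k ih =>
    intro x
    simp_rw [pow_succ, Matrix.mul_apply]
    rw [Finset.sum_comm]
    simp_rw [← Finset.mul_sum, h.row, mul_one]
    exact ih x

lemma pow_col (h : Good A T) (k : ℕ) (y : V) : ∑ x, (A ^ k) x y = 1 := by
  rw [← h.pow_row k y]
  exact Finset.sum_congr rfl fun x _ => h.pow_symm k x y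

lemma mv_apply (B : Matrix V V ℝ) (f : V → ℝ) (z : V) : B.mulVec f z = ∑ w, B z w * f w := rfl

lemma avg_mv (h : Good A T) (k : ℕ) (f : V → ℝ) : avg ((A ^ k).mulVec f) = avg f := by
  unfold avg
  congr 1
  simp_rw [mv_apply]
  rw [Finset.sum_comm]
  simp_rw [← Finset.sum_mul, h.pow_col, one_mul]

lemma mv_mono (h : Good A T) (k : ℕ) {f g : V → ℝ} (hfg : ∀ z, f z ≤ g z) (z : V) :
    (A ^ k).mulVec f z ≤ (A ^ k).mulVec g z := by
  simp_rw [mv_apply]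
  exact Finset.sum_le_sum fun w _ => mul_le_mul_of_nonneg_left (hfg w) (h.pow_nonneg k z w)

lemma mv_nonneg (h : Good A T) (k : ℕ) {f : V → ℝ} (hf : ∀ z, 0 ≤ f z) (z : V) :
    0 ≤ (A ^ k).mulVec f z := by
  simp_rw [mv_apply]
  exact Finset.sum_nonneg fun w _ => mul_nonneg (h.pow_nonneg k z w) (hf w)

lemma powT_le (h : Good A T) (x y : V) : (A ^ T) x y ≤ 5 / 4 / (Fintype.card V : ℝ) := by
  rw [le_div_iff₀ h.card_pos]
  have := (abs_le.1 (h.mix x y)).2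
  linarith

lemma mv_le (h : Good A T) {m : ℕ} (hm : T ≤ m) {f : V → ℝ} (hf : ∀ z, 0 ≤ f z) (z : V) :
    (A ^ m).mulVec f z ≤ 5 / 4 * avg f := by
  obtain ⟨k, rfl⟩ := Nat.exists_eq_add_of_le hm
  rw [pow_add, ← Matrix.mulVec_mulVec, ← h.avg_mv k f]
  have hg := h.mv_nonneg k hf
  set g := (A ^ k).mulVec f
  rw [mv_apply, avg]
  calc ∑ w, (A ^ T) z w * g w ≤ ∑ w, 5 / 4 / (Fintype.card V : ℝ) * g w :=
        Finset.sum_le_sum fun w _ => mul_le_mul_of_nonneg_right (h.powT_le z w) (hg w)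
    _ = _ := by rw [← Finset.mul_sum]; ring

lemma pow_le (h : Good A T) {m : ℕ} (hm : T ≤ m) (x y : V) :
    (A ^ m) x y ≤ 5 / 4 / (Fintype.card V : ℝ) := by
  have := h.mv_le hm (f := fun w => if w = y then 1 else 0) (fun z => by split_ifs <;> norm_num) x
  simp only [mv_apply, avg, mul_ite, mul_one, mul_zero, Finset.sum_ite_eq', Finset.mem_univ,
    if_true] at this
  linarith [this, show (5:ℝ) / 4 / (Fintype.card V : ℝ) = 5 / 4 * (1 / (Fintype.card V : ℝ)) by ring]

lemma mv_abs (h : Good A T) (f : V → ℝ) (z : V) :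
    |(A ^ T).mulVec f z - avg f| ≤ 1 / 4 * avg (fun w => |f w - avg f|) := by
  have hN := h.card_pos
  have e : (A ^ T).mulVec f z - avg f
      = ∑ w, ((A ^ T) z w - 1 / (Fintype.card V : ℝ)) * (f w - avg f) := by
    have h1 : ∑ w, (A ^ T) z w * avg f = avg f := by rw [← Finset.sum_mul, h.pow_row, one_mul]
    have h2 : ∑ w, (1 / (Fintype.card V : ℝ)) * (f w - avg f) = 0 := by
      rw [← Finset.mul_sum, Finset.sum_sub_distrib, Finset.sum_const, Finset.card_univ,
        nsmul_eq_mul, avg]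
      field_simp
      ring
    simp_rw [sub_mul]
    rw [Finset.sum_sub_distrib, h2, sub_zero]
    simp_rw [mul_sub]
    rw [Finset.sum_sub_distrib, h1, mv_apply]
  rw [e]
  generalize avg f = m
  refine (Finset.abs_sum_le_sum_abs _ _).trans ?_
  rw [avg, ← mul_div_assoc, Finset.mul_sum, Finset.sum_div]
  refine Finset.sum_le_sum fun w _ => ?_
  rw [abs_mul]
  have : |(A ^ T) z w - 1 / (Fintype.card V : ℝ)| ≤ 1 / 4 / (Fintype.card V : ℝ) := by
    rw [le_div_iff₀ hN, ← abs_of_pos hN, ← abs_mul, abs_of_pos hN, sub_mul,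
      one_div_mul_cancel hN.ne']
    exact h.mix z w
  calc _ ≤ 1 / 4 / (Fintype.card V : ℝ) * |f w - m| :=
        mul_le_mul_of_nonneg_right this (abs_nonneg _)
    _ = _ := by ring

lemma tele (h : Good A T) (U : ℕ → V → ℝ) (s : V → ℝ) (t : ℕ) (c : ℝ) (hs : ∀ z, 0 ≤ s z)
    (hge : ∀ t z, A.mulVec (U t) z - U (t + 1) z ≤ s z * A.mulVec (U t) z) (k : ℕ)
    (hc : ∀ i < k, ∀ z, A.mulVec (U (t + i)) z ≤ c) : ∀ z,
    (A ^ k).mulVec (U t) z - U (t + k) z ≤ c * ∑ i ∈ Finset.range k, (A ^ i).mulVec s z := by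
  induction k with
  | zero => intro z; simp
  | succ k ih =>
    intro z
    have ih' := ih (fun i hi => hc i (by omega))
    have h1 := h.mv_mono 1 ih' z
    have h2 := hge (t + k) z
    have h3 := hc k (by omega) z
    have h4 := mul_le_mul_of_nonneg_left h3 (hs z)
    rw [pow_one] at h1
    have h5 : A.mulVec (fun z => (A ^ k).mulVec (U t) z - U (t + k) z) z
        = (A ^ (k + 1)).mulVec (U t) z - A.mulVec (U (t + k)) z := by
      have : (fun z => (A ^ k).mulVec (U t) z - U (t + k) z) = (A ^ k).mulVec (U t) - U (t + k) := rfl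
      rw [this, Matrix.mulVec_sub, Matrix.mulVec_mulVec, ← pow_succ']
      rfl
    have h6 : A.mulVec (fun z => c * ∑ i ∈ Finset.range k, (A ^ i).mulVec s z) z
        = c * ∑ i ∈ Finset.range k, (A ^ (i + 1)).mulVec s z := by
      have : (fun z => c * ∑ i ∈ Finset.range k, (A ^ i).mulVec s z)
          = c • ∑ i ∈ Finset.range k, (A ^ i).mulVec s := by
        ext z; simp
      rw [this, Matrix.mulVec_smul, Matrix.mulVec_sum]
      simp [Matrix.mulVec_mulVec, pow_succ']
    rw [Finset.sum_range_succ', pow_zero, Matrix.one_mulVec, mul_add]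
    rw [h5, h6] at h1
    have : t + (k + 1) = t + k + 1 := by omega
    rw [this]
    linarith

lemma up (h : Good A T) (U : ℕ → V → ℝ) (hle : ∀ t z, U (t + 1) z ≤ A.mulVec (U t) z)
    (t k : ℕ) : ∀ z, U (t + k) z ≤ (A ^ k).mulVec (U t) z := by
  induction k with
  | zero => intro z; simp
  | succ k ih =>
    intro z
    refine (hle (t + k) z).trans ?_
    have := h.mv_mono 1 ih z
    rw [pow_one, Matrix.mulVec_mulVec, ← pow_succ'] at this
    exact this

lemma main_seq (h : Good A T) (U : ℕ → V → ℝ) (s : V → ℝ) (hs : ∀ z, 0 ≤ s z)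
    (hU0 : ∀ t ≤ 2 * T, ∀ z, U t z = 1)
    (hUn : ∀ t z, 0 ≤ U t z)
    (hle : ∀ t z, U (t + 1) z ≤ A.mulVec (U t) z)
    (hge : ∀ t z, A.mulVec (U t) z - U (t + 1) z ≤ s z * A.mulVec (U t) z)
    (r : V → ℝ) (hr : ∀ z, r z = ∑ i ∈ Finset.range T, (A ^ i).mulVec s z)
    (d : ℝ) (hrd : avg r ≤ d) (hd : d ≤ 3 / 20) (t : ℕ) (z : V) :
    |U t z - avg (U t)| ≤ 5 * avg (U t) * (r z + d) := by
  have hT := h.one_le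
  have hrn : ∀ z, 0 ≤ r z := fun z => by
    rw [hr]; exact Finset.sum_nonneg fun i _ => h.mv_nonneg i hs z
  have hdn : 0 ≤ d := (avg_nonneg hrn).trans hrd
  have han : ∀ t, 0 ≤ avg (U t) := fun t => avg_nonneg (hUn t)
  have h1 : ∀ t z, (A ^ T).mulVec (U (t + T)) z - U (t + T + T) z ≤ 5 / 4 * avg (U t) * r z := by
    intro t z
    rw [hr]
    refine h.tele U s (t + T) _ hs hge T (fun i _ z => ?_) z
    have e := h.mv_mono 1 (h.up U hle t (T + i)) z
    rw [pow_one, Matrix.mulVec_mulVec, ← pow_succ', ← add_assoc] at e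
    exact e.trans (h.mv_le (by omega) (hUn t) z)
  have h1' : ∀ t z, 0 ≤ (A ^ T).mulVec (U (t + T)) z - U (t + T + T) z := fun t z =>
    sub_nonneg.2 (h.up U hle (t + T) T z)
  have h2 : ∀ t, avg (U (t + T)) - avg (U (t + T + T)) ≤ 5 / 4 * avg (U t) * d := by
    intro t
    have := avg_mono (h1 t)
    rw [avg_sub, h.avg_mv, avg_mul] at this
    exact this.trans (mul_le_mul_of_nonneg_left hrd (by have := han t; positivity))
  have h2' : ∀ t, 0 ≤ avg (U (t + T)) - avg (U (t + T + T)) := by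
    intro t
    have := avg_nonneg (h1' t)
    rwa [avg_sub, h.avg_mv] at this
  have hone : ∀ t ≤ 2 * T, avg (U t) = 1 := fun t ht => by
    rw [show U t = fun _ => 1 from funext (hU0 t ht), h.avg_const]
  have h3 : ∀ t, avg (U t) ≤ 4 / 3 * avg (U (t + T)) := by
    intro t
    induction t using Nat.strong_induction_on with
    | _ t ih =>
      by_cases ht : t ≤ T
      · rw [hone t (by omega), hone (t + T) (by omega)]; norm_num
      · obtain ⟨k, rfl⟩ : ∃ k, t = k + T := ⟨t - T, by omega⟩
        have i1 := ih k (by omega)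
        have i2 := h2 k
        have := han k
        have := han (k + T)
        nlinarith [mul_le_mul_of_nonneg_left hd (han k)]
  have key : ∀ t, ∀ z, |U t z - avg (U t)| ≤ avg (U t) * (5 / 2 * r z + 5 * d) := by
    intro t
    induction t using Nat.strong_induction_on with
    | _ t ih =>
      by_cases ht : t ≤ 2 * T
      · intro z
        rw [hone t ht, hU0 t ht]
        have := hrn z
        simp; positivity
      · intro z
        obtain ⟨k, rfl⟩ : ∃ k, t = k + T + T := ⟨t - 2 * T, by omega⟩
        have i1 := avg_mono (ih (k + T) (by omega))
        rw [avg_mul, show avg (fun z => 5 / 2 * r z + 5 * d) = 5 / 2 * avg r + 5 * d by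
          have := avg_sub (fun z => 5 / 2 * r z) (fun z => - (5 * d))
          simp only [sub_neg_eq_add] at this
          rw [this, h.avg_const, avg_mul]; ring] at i1
        have i2 := h.mv_abs (U (k + T)) z
        have a1 := h1 k z
        have a1' := h1' k z
        have a2 := h2 k
        have a2' := h2' k
        have a3 := h3 k
        have a4 := h3 (k + T)
        have n0 := han k
        have n1 := han (k + T)
        have n2 := han (k + T + T)
        have rz := hrn z
        set a := avg (U k)
        set b := avg (U (k + T))
        set c := avg (U (k + T + T))
        have a5 : a ≤ 16 / 9 * c := by linarith
        have b1 : a * r z ≤ 16 / 9 * c * r z := mul_le_mul_of_nonneg_right a5 rz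
        have b2 : a * d ≤ 16 / 9 * c * d := mul_le_mul_of_nonneg_right a5 hdn
        have b3 : b * (5 / 2 * avg r + 5 * d) ≤ 4 / 3 * c * (15 / 2 * d) :=
          mul_le_mul a4 (by linarith) (by have := avg_nonneg hrn; positivity) (by positivity)
        have cr : 0 ≤ c * r z := by positivity
        have cd : 0 ≤ c * d := by positivity
        rw [abs_le] at i2 ⊢
        constructor <;> nlinarith
  refine (key t z).trans ?_
  have := han t
  have := hrn z
  nlinarith [mul_nonneg (han t) (hrn z)]

end Good
/-! ### Part B: kernel facts -/

abbrev KM (G : SimpleGraph V) : Matrix V V ℝ := Matrix.of (K G)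

lemma kpow_eq (G : SimpleGraph V) (t : ℕ) : ∀ x y, Kpow G t x y = (KM G ^ t) x y := by
  induction t with
  | zero => intro x y; rw [pow_zero, Matrix.one_apply]; rfl
  | succ t ih =>
    intro x y
    rw [pow_succ, Matrix.mul_apply, Kpow]
    exact Finset.sum_congr rfl fun z _ => by rw [ih]; rfl

lemma K_nonneg (G : SimpleGraph V) (x y : V) : 0 ≤ K G x y := by
  unfold K
  split_ifs <;> positivity

lemma K_row (G : SimpleGraph V) (x : V) : ∑ y, K G x y = 1 := by
  have e : ∀ y, K G x y = (if y = x then (if deg G x = 0 then 1 else 1 / 2) else 0)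
      + (if G.Adj x y then 1 / (2 * (deg G x : ℝ)) else 0) := by
    intro y
    unfold K
    by_cases hxy : x = y
    · subst hxy; simp
    · have hyx : ¬ y = x := fun h => hxy h.symm
      rw [if_neg hxy, if_neg hyx]; simp
  simp_rw [e]
  rw [Finset.sum_add_distrib, Finset.sum_ite_eq' Finset.univ x, if_pos (Finset.mem_univ _),
    ← Finset.sum_filter, Finset.sum_const]
  have : (Finset.univ.filter fun y => G.Adj x y).card = deg G x := rfl
  rw [this, nsmul_eq_mul]
  by_cases hd : deg G x = 0
  · simp [hd]
  · rw [if_neg hd]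
    have : (deg G x : ℝ) ≠ 0 := by exact_mod_cast hd
    field_simp
    norm_num

lemma deg_eq (G : SimpleGraph V) (h : IsVertexTransitive G) (x y : V) : deg G x = deg G y := by
  obtain ⟨e, rfl⟩ := h x y
  unfold deg
  refine Finset.card_bij (fun a _ => e a) ?_ ?_ ?_
  · intro a ha
    simp only [Finset.mem_filter, Finset.mem_univ, true_and] at ha ⊢
    exact e.map_adj_iff.2 ha
  · intro a _ b _ hab
    exact e.injective hab
  · intro b hb
    simp only [Finset.mem_filter, Finset.mem_univ, true_and] at hb
    refine ⟨e.symm b, ?_, by simp⟩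
    simp only [Finset.mem_filter, Finset.mem_univ, true_and]
    rw [← e.map_adj_iff]
    simpa using hb

lemma K_symm (G : SimpleGraph V) (h : IsVertexTransitive G) (x y : V) : K G x y = K G y x := by
  unfold K
  rw [deg_eq G h x y, G.adj_comm x y]
  by_cases hxy : x = y
  · rw [if_pos hxy, if_pos hxy.symm]
  · have hyx : ¬ y = x := fun h => hxy h.symm
    rw [if_neg hxy, if_neg hyx]

lemma good_K (G : SimpleGraph V) (h : IsVertexTransitive G) (hT : 1 ≤ Tmix G)
    (hN : 0 < Fintype.card V) : Good (KM G) (Tmix G) where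
  nonneg := K_nonneg G
  symm := K_symm G h
  row := K_row G
  mix := by
    have hne : {t : ℕ | ∀ x y : V, |Kpow G t x y / unif V - 1| ≤ 1 / 4}.Nonempty := by
      by_contra hcon
      rw [Set.not_nonempty_iff_eq_empty] at hcon
      have : Tmix G = 0 := by unfold Tmix; rw [hcon, Nat.sInf_empty]
      omega
    have := Nat.sInf_mem hne
    intro x y
    have h2 := this x y
    rw [unif, div_inv_eq_mul, kpow_eq] at h2
    exact h2
  one_le := hT
  card_pos := by exact_mod_cast hN

lemma green_eq (G : SimpleGraph V) (x y : V) :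
    green G x y = ∑ t ∈ Finset.range (Tmix G + 1), (KM G ^ t) x y := by
  unfold green
  exact Finset.sum_congr rfl fun t _ => kpow_eq G t x y

/-- probability of avoiding `S` up to time `t` -/
def uS (A : Matrix V V ℝ) (S : V → Prop) : ℕ → V → ℝ
  | 0 => fun z => if S z then 0 else 1
  | t + 1 => fun z => if S z then 0 else A.mulVec (uS A S t) z

lemma uS_zero (A : Matrix V V ℝ) (S : V → Prop) (z : V) : uS A S 0 z = if S z then 0 else 1 := rfl

lemma uS_succ (A : Matrix V V ℝ) (S : V → Prop) (t : ℕ) (z : V) :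
    uS A S (t + 1) z = if S z then 0 else A.mulVec (uS A S t) z := rfl

lemma uS_bound (G : SimpleGraph V) (h : Good (KM G) (Tmix G)) (x y : V) (hxy : x ≠ y)
    (d : ℝ) (hd0 : 2 * (Tmix G : ℝ) / (Fintype.card V : ℝ) ≤ d) (hd : d ≤ 3 / 20) (t : ℕ) (z : V) :
    |uS (KM G) (fun a => a = x ∨ a = y) t z - avg (uS (KM G) (fun a => a = x ∨ a = y) t)|
      ≤ 5 * avg (uS (KM G) (fun a => a = x ∨ a = y) t) * (green G z x + green G z y + d) := by
  set T := Tmix G with hTdef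
  set A := KM G
  generalize hS : (fun a => a = x ∨ a = y : V → Prop) = S
  set s : V → ℝ := fun a => if S a then 1 else 0 with hs
  set U : ℕ → V → ℝ := fun t => if t ≤ 2 * T then fun _ => 1 else uS A S (t - (2 * T + 1)) with hU
  have hsn : ∀ z, 0 ≤ s z := fun z => by simp only [hs]; split_ifs <;> norm_num
  have hone : A.mulVec (fun _ => 1) = fun _ => 1 := by
    ext a; rw [Good.mv_apply]; simp only [mul_one]; exact h.row a
  have hun : ∀ t z, 0 ≤ uS A S t z := by
    intro t
    induction t with
    | zero => intro z; rw [uS_zero]; split_ifs <;> norm_num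
    | succ t ih =>
      intro z; rw [uS_succ]; split_ifs
      · exact le_rfl
      · have := h.mv_nonneg 1 ih z
        rwa [pow_one] at this
  have hrec : ∀ t, (U (t + 1) = A.mulVec (U t)) ∨ U (t + 1) = fun z => if S z then 0 else A.mulVec (U t) z := by
    intro t
    rcases lt_trichotomy t (2 * T) with ht | ht | ht
    · left
      simp only [hU]
      rw [if_pos (by omega), if_pos (by omega), hone]
    · right
      simp only [hU]
      rw [if_neg (by omega), if_pos (by omega), hone, ht, Nat.sub_self]
      rfl
    · right
      simp only [hU]
      rw [if_neg (by omega), if_neg (by omega), show t + 1 - (2 * T + 1) = t - (2 * T + 1) + 1 by omega]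
      rfl
  have hUn : ∀ t z, 0 ≤ U t z := by
    intro t z
    simp only [hU]
    split_ifs
    · norm_num
    · exact hun _ z
  have hAUn : ∀ t z, 0 ≤ A.mulVec (U t) z := fun t z => by
    have := h.mv_nonneg 1 (hUn t) z
    rwa [pow_one] at this
  have hsv : ∀ i z, (A ^ i).mulVec s z = (A ^ i) z x + (A ^ i) z y := by
    intro i z
    have : s = fun a => (if a = x then 1 else 0) + (if a = y then 1 else 0) := by
      ext a
      simp only [hs, ← hS]
      by_cases h1 : a = x
      · subst h1; simp [hxy]
      · simp [h1]
    rw [this, Good.mv_apply]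
    simp [mul_add, Finset.sum_add_distrib]
  set r : V → ℝ := fun z => ∑ i ∈ Finset.range T, (A ^ i).mulVec s z with hr
  have key := h.main_seq U s hsn (fun t ht z => by simp only [hU]; rw [if_pos ht]) hUn
    (fun t z => by
      rcases hrec t with e | e
      · rw [e]
      · rw [e]; dsimp only; split_ifs
        · exact hAUn t z
        · exact le_rfl)
    (fun t z => by
      have := hAUn t z
      rcases hrec t with e | e
      · rw [e, sub_self]; exact mul_nonneg (hsn z) this
      · rw [e]
        by_cases hz : S z
        · simp only [hs, if_pos hz]; linarith
        · simp only [hs, if_neg hz]; linarith)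
    r (fun z => rfl) d (by
      refine le_trans (le_of_eq ?_) hd0
      unfold avg
      congr 1
      simp only [hr, hsv]
      rw [Finset.sum_comm]
      simp only [Finset.sum_add_distrib, h.pow_col]
      simp; ring) hd (t + (2 * T + 1)) z
  have hUt : U (t + (2 * T + 1)) = uS A S t := by
    simp only [hU]
    rw [if_neg (by omega), Nat.add_sub_cancel]
  rw [hUt] at key
  refine key.trans (mul_le_mul_of_nonneg_left ?_ (by have := avg_nonneg (hun t); positivity))
  have : r z ≤ green G z x + green G z y := by
    simp only [hr, hsv, green_eq]
    rw [← Finset.sum_add_distrib]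
    refine Finset.sum_le_sum_of_subset_of_nonneg (Finset.range_mono (by omega)) ?_
    intro i _ _
    exact add_nonneg (h.pow_nonneg i z x) (h.pow_nonneg i z y)
  linarith

lemma uS_nonneg (G : SimpleGraph V) (S : V → Prop) (t : ℕ) : ∀ z, 0 ≤ uS (KM G) S t z := by
  induction t with
  | zero => intro z; rw [uS_zero]; split_ifs <;> norm_num
  | succ t ih =>
    intro z; rw [uS_succ]; split_ifs
    · exact le_rfl
    · rw [Good.mv_apply]
      exact Finset.sum_nonneg fun w _ => mul_nonneg (K_nonneg G z w) (ih w)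
/-! ### Part C: path sums -/

def extp {n : ℕ} (v : Fin (n + 1) → V) : ℕ → V := fun i => v ⟨min i n, by omega⟩

/-- total weight of paths up to time `n` satisfying `F` -/
def W (G : SimpleGraph V) (init : V → ℝ) (n : ℕ) (F : (ℕ → V) → Prop) : ℝ :=
  ∑ v : Fin (n + 1) → V, if F (extp v) then walkP G init n (extp v) else 0

def Dep (n : ℕ) (F : (ℕ → V) → Prop) : Prop :=
  ∀ v v' : ℕ → V, (∀ i ≤ n, v i = v' i) → (F v ↔ F v')

def Dep2 (n : ℕ) (F : (ℕ → V) → (ℕ → V) → Prop) : Prop :=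
  ∀ v v' w w' : ℕ → V, (∀ i ≤ n, v i = v' i) → (∀ i ≤ n, w i = w' i) → (F v w ↔ F v' w')

lemma walkP_congr (G : SimpleGraph V) (init : V → ℝ) (n : ℕ) {v v' : ℕ → V}
    (h : ∀ i ≤ n, v i = v' i) : walkP G init n v = walkP G init n v' := by
  unfold walkP
  rw [h 0 (by omega)]
  congr 1
  refine Finset.prod_congr rfl fun i hi => ?_
  rw [Finset.mem_range] at hi
  rw [h i (by omega), h (i + 1) (by omega)]

lemma walkP_nonneg (G : SimpleGraph V) (init : V → ℝ) (hi : ∀ x, 0 ≤ init x) (n : ℕ) (v : ℕ → V) :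
    0 ≤ walkP G init n v :=
  mul_nonneg (hi _) (Finset.prod_nonneg fun _ _ => K_nonneg G _ _)

lemma W_nonneg (G : SimpleGraph V) (init : V → ℝ) (hi : ∀ x, 0 ≤ init x) (n : ℕ)
    (F : (ℕ → V) → Prop) : 0 ≤ W G init n F := by
  unfold W
  refine Finset.sum_nonneg fun v _ => ?_
  split_ifs
  · exact walkP_nonneg G init hi n _
  · exact le_rfl

lemma extp_snoc_le {n : ℕ} (v : Fin (n + 1) → V) (b : V) (i : ℕ) (hi : i ≤ n) :
    extp (n := n + 1) (Fin.snoc v b) i = extp v i := by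
  unfold extp
  have e : (⟨min i (n + 1), by omega⟩ : Fin (n + 1 + 1)) = Fin.castSucc ⟨min i n, by omega⟩ := by
    ext; simp; omega
  rw [e, Fin.snoc_castSucc]

lemma extp_snoc_last {n : ℕ} (v : Fin (n + 1) → V) (b : V) :
    extp (n := n + 1) (Fin.snoc v b) (n + 1) = b := by
  unfold extp
  have e : (⟨min (n + 1) (n + 1), by omega⟩ : Fin (n + 1 + 1)) = Fin.last (n + 1) := by
    ext; simp
  rw [e, Fin.snoc_last]

lemma sum_snoc {n : ℕ} (f : (Fin (n + 1 + 1) → V) → ℝ) :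
    ∑ v, f v = ∑ v : Fin (n + 1) → V, ∑ b, f (Fin.snoc v b) := by
  rw [← (Fin.snocEquiv (fun _ => V)).sum_comp, Fintype.sum_prod_type, Finset.sum_comm]
  rfl

lemma walkP_snoc (G : SimpleGraph V) (init : V → ℝ) {n : ℕ} (v : Fin (n + 1) → V) (b : V) :
    walkP G init (n + 1) (extp (n := n + 1) (Fin.snoc v b))
      = walkP G init n (extp v) * K G (extp v n) b := by
  have : walkP G init (n + 1) (extp (n := n + 1) (Fin.snoc v b))
      = walkP G init n (extp (n := n + 1) (Fin.snoc v b))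
        * K G (extp (n := n + 1) (Fin.snoc v b) n) (extp (n := n + 1) (Fin.snoc v b) (n + 1)) := by
    unfold walkP
    rw [Finset.prod_range_succ, mul_assoc]
  rw [this, extp_snoc_last, extp_snoc_le v b n le_rfl,
    walkP_congr G init n (fun i hi => extp_snoc_le v b i hi)]

lemma W_succ (G : SimpleGraph V) (init : V → ℝ) (n : ℕ) (F : (ℕ → V) → Prop) (hF : Dep n F) :
    W G init (n + 1) F = W G init n F := by
  unfold W
  rw [sum_snoc]
  refine Finset.sum_congr rfl fun v _ => ?_
  have e : ∀ b, F (extp (n := n + 1) (Fin.snoc v b)) ↔ F (extp v) := fun b =>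
    hF _ _ fun i hi => extp_snoc_le v b i hi
  simp_rw [e, walkP_snoc]
  by_cases h : F (extp v)
  · simp only [if_pos h]
    rw [← Finset.mul_sum, K_row, mul_one]
  · simp [if_neg h]

lemma Dep.mono {n m : ℕ} (h : n ≤ m) {F : (ℕ → V) → Prop} (hF : Dep n F) : Dep m F :=
  fun v v' hv => hF v v' fun i hi => hv i (by omega)

lemma W_add (G : SimpleGraph V) (init : V → ℝ) (n k : ℕ) (F : (ℕ → V) → Prop) (hF : Dep n F) :
    W G init (n + k) F = W G init n F := by
  induction k with
  | zero => rfl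
  | succ k ih => rw [← add_assoc, W_succ G init _ F (hF.mono (by omega)), ih]

/-- law of the endpoint of the killed walk -/
def phi (G : SimpleGraph V) (init : V → ℝ) (S : V → Prop) : ℕ → V → ℝ
  | 0 => fun b => if S b then 0 else init b
  | n + 1 => fun b => if S b then 0 else ∑ a, phi G init S n a * K G a b

lemma W_end (G : SimpleGraph V) (init : V → ℝ) (S : V → Prop) (n : ℕ) : ∀ b,
    W G init n (fun v => (∀ i ≤ n, ¬ S (v i)) ∧ v n = b) = phi G init S n b := by
  induction n with
  | zero =>
    intro b
    unfold W
    rw [← (Equiv.funUnique (Fin 1) V).symm.sum_comp]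
    have e : ∀ a, ∀ i, extp (n := 0) ((Equiv.funUnique (Fin 1) V).symm a) i = a := fun a i => rfl
    simp only [e, walkP, Finset.range_zero, Finset.prod_empty, mul_one, phi]
    simp only [Nat.le_zero, forall_eq]
    rw [Finset.sum_eq_single b]
    · by_cases hb : S b <;> simp [hb]
    · intro a _ hab; simp [hab]
    · simp
  | succ n ih =>
    intro b
    rw [phi]
    simp_rw [← ih]
    unfold W
    rw [sum_snoc]
    simp_rw [walkP_snoc, Finset.sum_mul]
    have e : ∀ (v : Fin (n + 1) → V) (c : V),
        ((∀ i ≤ n + 1, ¬ S (extp (n := n + 1) (Fin.snoc v c) i))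
          ∧ extp (n := n + 1) (Fin.snoc v c) (n + 1) = b)
        ↔ (∀ i ≤ n, ¬ S (extp v i)) ∧ ¬ S b ∧ c = b := by
      intro v c
      rw [extp_snoc_last]
      constructor
      · rintro ⟨h1, rfl⟩
        refine ⟨fun i hi => ?_, ?_, rfl⟩
        · have := h1 i (by omega); rwa [extp_snoc_le v c i hi] at this
        · have := h1 (n + 1) le_rfl; rwa [extp_snoc_last] at this
      · rintro ⟨h1, h2, rfl⟩
        refine ⟨fun i hi => ?_, rfl⟩
        rcases Nat.lt_or_ge n i with h | h
        · have : i = n + 1 := by omega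
          rw [this, extp_snoc_last]; exact h2
        · rw [extp_snoc_le v c i h]; exact h1 i h
    simp_rw [e]
    by_cases hb : S b
    · simp [hb]
    · rw [if_neg hb, Finset.sum_comm (s := (Finset.univ : Finset V))]
      refine Finset.sum_congr rfl fun v _ => ?_
      by_cases hv : ∀ i ≤ n, ¬ S (extp v i)
      · simp only [hb]
        rw [Finset.sum_eq_single b, Finset.sum_eq_single (extp v n)]
        · simp
        · intro a _ ha; simp [ha.symm]
        · simp
        · intro a _ ha; simp [ha]
        · simp
      · simp only [hv, false_and, if_false, zero_mul, Finset.sum_const_zero]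

lemma phi_unif (G : SimpleGraph V) (h : IsVertexTransitive G) (S : V → Prop) (n : ℕ) : ∀ b,
    phi G (uinit V) S n b = uS (KM G) S n b / (Fintype.card V : ℝ) := by
  induction n with
  | zero => intro b; change (if S b then 0 else uinit V b) = (if S b then 0 else 1) / _; split_ifs <;> simp [uinit]
  | succ n ih =>
    intro b
    rw [uS_succ]
    change (if S b then 0 else ∑ a, phi G (uinit V) S n a * K G a b) = _
    split_ifs
    · simp
    · rw [Good.mv_apply, Finset.sum_div]
      refine Finset.sum_congr rfl fun a _ => ?_
      rw [ih, K_symm G h a b]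
      simp only [Matrix.of_apply]
      ring

lemma phi_delta (G : SimpleGraph V) (x : V) (n : ℕ) : ∀ b,
    phi G (delta x) (fun _ => False) n b = Kpow G n x b := by
  induction n with
  | zero => intro b; simp [phi, delta, Kpow, eq_comm]
  | succ n ih => intro b; simp [phi, Kpow, ih]

lemma W_point (G : SimpleGraph V) (x : V) (s n : ℕ) (hs : s ≤ n) (b : V) :
    W G (delta x) n (fun v => v s = b) = Kpow G s x b := by
  obtain ⟨k, rfl⟩ := Nat.exists_eq_add_of_le hs
  rw [W_add]
  · rw [← phi_delta, ← W_end]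
    simp
  · intro v v' h
    simp only [h s le_rfl]

variable {Ω : Type*} [MeasurableSpace Ω]

lemma cyl_meas {G : SimpleGraph V} {P : Measure Ω} {X₁ X₂ : ℕ → Ω → V} {i₁ i₂ : V → ℝ}
    (h : IsWalkPair G P X₁ X₂ i₁ i₂) (n : ℕ) (v w : ℕ → V) :
    MeasurableSet {ω | (∀ i ≤ n, X₁ i ω = v i) ∧ ∀ i ≤ n, X₂ i ω = w i} := by
  have : {ω | (∀ i ≤ n, X₁ i ω = v i) ∧ ∀ i ≤ n, X₂ i ω = w i}
      = (⋂ i, ⋂ (_ : i ≤ n), {ω | X₁ i ω = v i}) ∩ ⋂ i, ⋂ (_ : i ≤ n), {ω | X₂ i ω = w i} := by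
    ext ω; simp
  rw [this]
  exact (MeasurableSet.iInter fun i => MeasurableSet.iInter fun _ => h.meas₁ i _).inter
    (MeasurableSet.iInter fun i => MeasurableSet.iInter fun _ => h.meas₂ i _)

lemma event_eq (X₁ X₂ : ℕ → Ω → V) (n : ℕ) (F : (ℕ → V) → (ℕ → V) → Prop) (hF : Dep2 n F) :
    {ω | F (fun i => X₁ i ω) (fun i => X₂ i ω)}
      = ⋃ p ∈ (Finset.univ.filter fun p : (Fin (n + 1) → V) × (Fin (n + 1) → V) =>
          F (extp p.1) (extp p.2)),
        {ω | (∀ i ≤ n, X₁ i ω = extp p.1 i) ∧ ∀ i ≤ n, X₂ i ω = extp p.2 i} := by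
  ext ω
  simp only [Set.mem_ofPred_eq, Finset.mem_filter, Finset.mem_univ, true_and, Set.mem_iUnion,
    exists_prop]
  constructor
  · intro hω
    have e1 : ∀ i ≤ n, X₁ i ω = extp (n := n) (fun j : Fin (n + 1) => X₁ j ω) i := by
      intro i hi; simp [extp, hi]
    have e2 : ∀ i ≤ n, X₂ i ω = extp (n := n) (fun j : Fin (n + 1) => X₂ j ω) i := by
      intro i hi; simp [extp, hi]
    exact ⟨(fun j => X₁ j ω, fun j => X₂ j ω), (hF _ _ _ _ e1 e2).1 hω, e1, e2⟩
  · rintro ⟨p, hp, e1, e2⟩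
    exact (hF _ _ _ _ e1 e2).2 hp

lemma event_meas {G : SimpleGraph V} {P : Measure Ω} {X₁ X₂ : ℕ → Ω → V} {i₁ i₂ : V → ℝ}
    (h : IsWalkPair G P X₁ X₂ i₁ i₂) (n : ℕ) (F : (ℕ → V) → (ℕ → V) → Prop) (hF : Dep2 n F) :
    MeasurableSet {ω | F (fun i => X₁ i ω) (fun i => X₂ i ω)} := by
  rw [event_eq X₁ X₂ n F hF]
  exact Finset.measurableSet_biUnion _ fun p _ => cyl_meas h n _ _

lemma event_prob {G : SimpleGraph V} {P : Measure Ω} [IsProbabilityMeasure P]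
    {X₁ X₂ : ℕ → Ω → V} {i₁ i₂ : V → ℝ}
    (h : IsWalkPair G P X₁ X₂ i₁ i₂) (n : ℕ) (F : (ℕ → V) → (ℕ → V) → Prop) (hF : Dep2 n F) :
    (P {ω | F (fun i => X₁ i ω) (fun i => X₂ i ω)}).toReal
      = ∑ v : Fin (n + 1) → V, ∑ w : Fin (n + 1) → V,
        if F (extp v) (extp w) then walkP G i₁ n (extp v) * walkP G i₂ n (extp w) else 0 := by
  rw [event_eq X₁ X₂ n F hF, measure_biUnion_finset, ENNReal.toReal_sum]
  · rw [Finset.sum_filter, Fintype.sum_prod_type]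
    refine Finset.sum_congr rfl fun v _ => Finset.sum_congr rfl fun w _ => ?_
    rw [h.law]
  · intro p _; exact measure_ne_top _ _
  · intro p _ q _ hpq
    rw [Function.onFun, Set.disjoint_left]
    rintro ω ⟨e1, e2⟩ ⟨e3, e4⟩
    apply hpq
    have aux : ∀ a b : Fin (n + 1) → V, (∀ i ≤ n, extp a i = extp b i) → a = b := by
      intro a b hab
      ext j
      have := hab j (by omega)
      have hj : min (j : ℕ) n = j := by omega
      simpa [extp, hj] using this
    exact Prod.ext (aux _ _ fun i hi => (e1 i hi).symm.trans (e3 i hi))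
      (aux _ _ fun i hi => (e2 i hi).symm.trans (e4 i hi))
  · intro p _; exact cyl_meas h n _ _

lemma event_prod {G : SimpleGraph V} {P : Measure Ω} [IsProbabilityMeasure P]
    {X₁ X₂ : ℕ → Ω → V} {i₁ i₂ : V → ℝ}
    (h : IsWalkPair G P X₁ X₂ i₁ i₂) (n : ℕ) (F₁ F₂ : (ℕ → V) → Prop)
    (h₁ : Dep n F₁) (h₂ : Dep n F₂) :
    (P {ω | F₁ (fun i => X₁ i ω) ∧ F₂ (fun i => X₂ i ω)}).toReal
      = W G i₁ n F₁ * W G i₂ n F₂ := by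
  have := event_prob h n (fun v w => F₁ v ∧ F₂ w) (fun v v' w w' hv hw => by
    exact and_congr (h₁ v v' hv) (h₂ w w' hw))
  rw [this]
  unfold W
  rw [Finset.sum_mul_sum]
  refine Finset.sum_congr rfl fun v _ => Finset.sum_congr rfl fun w _ => ?_
  by_cases a : F₁ (extp v) <;> by_cases b : F₂ (extp w) <;> simp [a, b]

lemma hit_le (X : ℕ → Ω → V) (x : V) (ω : Ω) (t : ℕ) :
    hitTime X x ω ≤ (t : ℕ∞) ↔ ∃ s ≤ t, X s ω = x := by
  constructor
  · intro h
    by_contra hcon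
    push Not at hcon
    have : ((t + 1 : ℕ) : ℕ∞) ≤ hitTime X x ω := by
      unfold hitTime
      refine le_iInf₂ fun s hs => ?_
      have : ¬ s ≤ t := fun h' => hcon s h' hs
      exact_mod_cast (by omega : t + 1 ≤ s)
    have h2 := this.trans h
    have : t + 1 ≤ t := by exact_mod_cast h2
    omega
  · rintro ⟨s, hs, e⟩
    refine (iInf₂_le s e).trans ?_
    exact_mod_cast hs

lemma lt_hit (X : ℕ → Ω → V) (x : V) (ω : Ω) (t : ℕ) :
    (t : ℕ∞) < hitTime X x ω ↔ ∀ s ≤ t, X s ω ≠ x := by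
  rw [← not_le, hit_le]; push Not; rfl
/-! ### Part D: the conditional law -/

lemma hit_eq (X : ℕ → Ω → V) (x : V) (ω : Ω) (t : ℕ) :
    hitTime X x ω = (t : ℕ∞) ↔ X t ω = x ∧ ∀ s < t, X s ω ≠ x := by
  constructor
  · intro h
    obtain ⟨s, hs, e⟩ := (hit_le X x ω t).1 h.le
    have h2 : ∀ s < t, X s ω ≠ x := fun s hs => by
      have : (s : ℕ∞) < hitTime X x ω := by rw [h]; exact_mod_cast hs
      exact (lt_hit X x ω s).1 this s le_rfl
    refine ⟨?_, h2⟩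
    rcases Nat.lt_or_ge s t with h' | h'
    · exact absurd e (h2 s h')
    · rwa [show t = s by omega]
  · rintro ⟨h1, h2⟩
    refine le_antisymm ((hit_le X x ω t).2 ⟨t, le_rfl, h1⟩) ?_
    unfold hitTime
    refine le_iInf₂ fun s hs => ?_
    have : ¬ s < t := fun h' => h2 s h' hs
    exact_mod_cast (by omega : t ≤ s)

def F1 (x y : V) (t : ℕ) (v : ℕ → V) : Prop :=
  v t = x ∧ (∀ s < t, v s ≠ x) ∧ ∀ s ≤ t, v s ≠ y

def F2 (x y z : V) (t : ℕ) (w : ℕ → V) : Prop :=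
  (∀ i ≤ t, ¬ (fun a => a = x ∨ a = y) (w i)) ∧ w t = z

lemma dep_F1 (x y : V) (t : ℕ) : Dep t (F1 x y t) := by
  intro v v' h
  unfold F1
  rw [h t le_rfl]
  refine and_congr Iff.rfl (and_congr ?_ ?_)
  · exact forall₂_congr fun s hs => by rw [h s (by omega)]
  · exact forall₂_congr fun s hs => by rw [h s (by omega)]

lemma dep_F2 (x y z : V) (t : ℕ) : Dep t (F2 x y z t) := by
  intro v v' h
  unfold F2
  rw [h t le_rfl]
  refine and_congr ?_ Iff.rfl
  exact forall₂_congr fun s hs => by rw [h s (by omega)]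

lemma H_eq (X₁ X₂ : ℕ → Ω → V) (x y z : V) :
    Hevent X₁ X₂ x y ∩ {ω | Ytwo X₁ X₂ x y ω = z}
      = ⋃ t : ℕ, {ω | F1 x y t (fun i => X₁ i ω) ∧ F2 x y z t (fun i => X₂ i ω)} := by
  ext ω
  simp only [Set.mem_iUnion, Set.mem_inter_iff, Set.mem_ofPred_eq, Hevent, lt_min_iff]
  constructor
  · rintro ⟨⟨h1, h2, h3⟩, h4⟩
    obtain ⟨t, ht⟩ := ENat.ne_top_iff_exists.1 (ne_top_of_lt h1)
    rw [← ht] at h1 h2 h3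
    have hm : hitTime2 X₁ x y ω = (t : ℕ∞) := by
      unfold hitTime2; rw [← ht]; exact min_eq_left h1.le
    rw [Ytwo, hm, ENat.toNat_natCast] at h4
    rw [lt_hit] at h1 h2 h3
    have h5 := (hit_eq X₁ x ω t).1 ht.symm
    refine ⟨t, ⟨h5.1, h5.2, h1⟩, fun i hi => ?_, h4⟩
    rintro (h | h)
    · exact h2 i hi h
    · exact h3 i hi h
  · rintro ⟨t, ⟨h1, h2, h3⟩, h4, h5⟩
    have ht := (hit_eq X₁ x ω t).2 ⟨h1, h2⟩
    have a1 := (lt_hit X₁ y ω t).2 h3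
    have a2 := (lt_hit X₂ x ω t).2 fun s hs h => h4 s hs (Or.inl h)
    have a3 := (lt_hit X₂ y ω t).2 fun s hs h => h4 s hs (Or.inr h)
    have hm : hitTime2 X₁ x y ω = (t : ℕ∞) := by
      unfold hitTime2; rw [ht]; exact min_eq_left a1.le
    rw [ht, Ytwo, hm, ENat.toNat_natCast]
    exact ⟨⟨a1, a2, a3⟩, h5⟩

lemma E_dep (x y z : V) (t : ℕ) : Dep2 t (fun v w => F1 x y t v ∧ F2 x y z t w) :=
  fun v v' w w' hv hw => and_congr (dep_F1 x y t v v' hv) (dep_F2 x y z t w w' hw)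

lemma H_hasSum {G : SimpleGraph V} (hvt : IsVertexTransitive G) {P : Measure Ω}
    [IsProbabilityMeasure P] {X₁ X₂ : ℕ → Ω → V}
    (h : IsWalkPair G P X₁ X₂ (uinit V) (uinit V)) (x y z : V) :
    HasSum (fun t => W G (uinit V) t (F1 x y t)
        * (uS (KM G) (fun a => a = x ∨ a = y) t z / (Fintype.card V : ℝ)))
      (P (Hevent X₁ X₂ x y ∩ {ω | Ytwo X₁ X₂ x y ω = z})).toReal := by
  have hterm : ∀ t, (P {ω | F1 x y t (fun i => X₁ i ω) ∧ F2 x y z t (fun i => X₂ i ω)}).toReal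
      = W G (uinit V) t (F1 x y t)
        * (uS (KM G) (fun a => a = x ∨ a = y) t z / (Fintype.card V : ℝ)) := by
    intro t
    rw [event_prod h t _ _ (dep_F1 x y t) (dep_F2 x y z t), ← phi_unif G hvt, ← W_end]
    rfl
  simp_rw [← hterm]
  rw [H_eq, measure_iUnion]
  · rw [ENNReal.tsum_toReal_eq (fun t => measure_ne_top _ _)]
    refine ENNReal.hasSum_toReal ?_
    rw [← measure_iUnion]
    · exact measure_ne_top _ _
    all_goals first
      | exact fun t => event_meas h t _ (E_dep x y z t)
      | skip
    intro t t' htt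
    rw [Function.onFun, Set.disjoint_left]
    rintro ω ⟨⟨a, b, _⟩, _⟩ ⟨⟨a', b', _⟩, _⟩
    rcases lt_or_gt_of_ne htt with hl | hl
    · exact b' _ hl a
    · exact b _ hl a'
  · intro t t' htt
    rw [Function.onFun, Set.disjoint_left]
    rintro ω ⟨⟨a, b, _⟩, _⟩ ⟨⟨a', b', _⟩, _⟩
    rcases lt_or_gt_of_ne htt with hl | hl
    · exact b' _ hl a
    · exact b _ hl a'
  · exact fun t => event_meas h t _ (E_dep x y z t)

lemma uinit_nonneg (x : V) : 0 ≤ uinit V x := by unfold uinit; positivity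

lemma H_meas {G : SimpleGraph V} {P : Measure Ω}
    {X₁ X₂ : ℕ → Ω → V} {i₁ i₂ : V → ℝ} (h : IsWalkPair G P X₁ X₂ i₁ i₂) (x y z : V) :
    MeasurableSet (Hevent X₁ X₂ x y ∩ {ω | Ytwo X₁ X₂ x y ω = z}) := by
  rw [H_eq]
  exact MeasurableSet.iUnion fun t => event_meas h t _ (E_dep x y z t)

lemma H_sum {G : SimpleGraph V} {P : Measure Ω} [IsProbabilityMeasure P]
    {X₁ X₂ : ℕ → Ω → V} {i₁ i₂ : V → ℝ} (h : IsWalkPair G P X₁ X₂ i₁ i₂) (x y : V) :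
    (P (Hevent X₁ X₂ x y)).toReal
      = ∑ z, (P (Hevent X₁ X₂ x y ∩ {ω | Ytwo X₁ X₂ x y ω = z})).toReal := by
  have : Hevent X₁ X₂ x y
      = ⋃ z ∈ (Finset.univ : Finset V), (Hevent X₁ X₂ x y ∩ {ω | Ytwo X₁ X₂ x y ω = z}) := by
    ext ω; simp
  conv_lhs => rw [this]
  rw [measure_biUnion_finset, ENNReal.toReal_sum]
  · intro p _; exact measure_ne_top _ _
  · intro p _ q _ hpq
    rw [Function.onFun, Set.disjoint_left]
    rintro ω ⟨_, e1⟩ ⟨_, e2⟩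
    exact hpq (e1.symm.trans e2)
  · exact fun z _ => H_meas h x y z

lemma pitilde_y (P : Measure Ω) (X₁ X₂ : ℕ → Ω → V) (x y : V) :
    pitilde P X₁ X₂ x y y = 0 := by
  unfold pitilde
  rw [H_eq]
  have : (⋃ t : ℕ, {ω | F1 x y t (fun i => X₁ i ω) ∧ F2 x y y t (fun i => X₂ i ω)}) = ∅ := by
    ext ω
    simp only [Set.mem_iUnion, Set.mem_ofPred_eq, Set.mem_empty_iff_false, iff_false, not_exists]
    rintro t ⟨_, h1, h2⟩
    exact h1 t le_rfl (Or.inr h2)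
  rw [this]; simp

lemma pitilde_bound {G : SimpleGraph V} (hvt : IsVertexTransitive G) {P : Measure Ω}
    [IsProbabilityMeasure P] {X₁ X₂ : ℕ → Ω → V}
    (h : IsWalkPair G P X₁ X₂ (uinit V) (uinit V)) (hG : Good (KM G) (Tmix G))
    (hN : 3 ≤ Fintype.card V) (x y : V) (hxy : x ≠ y)
    (d : ℝ) (hd0 : 2 * (Tmix G : ℝ) / (Fintype.card V : ℝ) ≤ d) (hd : d ≤ 3 / 20) (z : V) :
    |pitilde P X₁ X₂ x y z - 1 / (Fintype.card V : ℝ)|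
      ≤ 5 / (Fintype.card V : ℝ) * (green G z x + green G z y + d) := by
  have hNp := hG.card_pos
  set N : ℝ := (Fintype.card V : ℝ) with hNdef
  set S : V → Prop := fun a => a = x ∨ a = y
  set m : V → ℝ := fun z => (P (Hevent X₁ X₂ x y ∩ {ω | Ytwo X₁ X₂ x y ω = z})).toReal with hm
  set a : ℕ → ℝ := fun t => W G (uinit V) t (F1 x y t) with ha
  set u : ℕ → V → ℝ := uS (KM G) S with hu
  have han : ∀ t, 0 ≤ a t := fun t => W_nonneg G _ uinit_nonneg t _
  have hun : ∀ t z, 0 ≤ u t z := fun t z => uS_nonneg G S t z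
  have hs : ∀ z, HasSum (fun t => a t * (u t z / N)) (m z) := fun z => H_hasSum hvt h x y z
  have hH : (P (Hevent X₁ X₂ x y)).toReal = ∑ z, m z := H_sum h x y
  have hsavg : HasSum (fun t => a t * (avg (u t) / N)) (avg m) := by
    have h1 := (hasSum_sum (s := Finset.univ) fun z _ => hs z).div_const N
    have e : ∀ t, a t * (avg (u t) / N) = (∑ z, a t * (u t z / N)) / N := by
      intro t
      rw [avg, ← Finset.mul_sum, ← Finset.sum_div, mul_div_assoc]
    simp_rw [e]
    exact h1
  have key : |m z - avg m| ≤ 5 * (green G z x + green G z y + d) * avg m := by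
    have s1 := (hs z).sub hsavg
    have s2 := hsavg.mul_left (5 * (green G z x + green G z y + d))
    have hb : ∀ t, |a t * (u t z / N) - a t * (avg (u t) / N)|
        ≤ 5 * (green G z x + green G z y + d) * (a t * (avg (u t) / N)) := by
      intro t
      have := uS_bound G hG x y hxy d hd0 hd t z
      rw [← mul_sub, abs_mul, abs_of_nonneg (han t), ← sub_div, abs_div, abs_of_pos hNp]
      calc a t * (|u t z - avg (u t)| / N)
          ≤ a t * ((5 * avg (u t) * (green G z x + green G z y + d)) / N) :=
            mul_le_mul_of_nonneg_left (div_le_div_of_nonneg_right this hNp.le) (han t)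
        _ = _ := by ring
    rw [abs_le]
    constructor
    · exact hasSum_le (fun t => (abs_le.1 (hb t)).1) s2.neg s1
    · exact hasSum_le (fun t => (abs_le.1 (hb t)).2) s1 s2
  have hpos : 0 < ∑ z, m z := by
    obtain ⟨b, hb⟩ : ∃ b, b ∉ ({x, y} : Finset V) := by
      by_contra hcon
      push Not at hcon
      have h1 : Fintype.card V ≤ ({x, y} : Finset V).card :=
        Finset.card_le_card (fun b _ => hcon b)
      have h2 : ({x, y} : Finset V).card ≤ 2 := Finset.card_le_two
      omega
    simp only [Finset.mem_insert, Finset.mem_singleton] at hb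
    have hmn : ∀ z, 0 ≤ m z := fun z => ENNReal.toReal_nonneg
    refine Finset.sum_pos' (fun z _ => hmn z) ⟨b, Finset.mem_univ _, ?_⟩
    have h1 : a 0 * (u 0 b / N) ≤ m b :=
      le_hasSum (hs b) 0 fun t _ => mul_nonneg (han t) (div_nonneg (hun t b) hNp.le)
    refine lt_of_lt_of_le ?_ h1
    have hu0 : u 0 b = 1 := by
      rw [hu, uS_zero, if_neg hb]
    have ha0 : a 0 = 1 / N := by
      have := W_end G (uinit V) (fun _ => False) 0 x
      have e2 : phi G (uinit V) (fun _ => False) 0 x = 1 / N := by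
        simp [phi, uinit, hNdef]
      rw [e2] at this
      rw [← this, ha]
      unfold W
      refine Finset.sum_congr rfl fun v _ => ?_
      have : F1 x y 0 (extp v) ↔ ((∀ i ≤ 0, ¬ False) ∧ extp v 0 = x) := by
        unfold F1
        constructor
        · rintro ⟨h1, -, -⟩; exact ⟨fun _ _ => not_false, h1⟩
        · rintro ⟨-, h1⟩
          refine ⟨h1, fun s hs => absurd hs (Nat.not_lt_zero s), fun s hs => ?_⟩
          rw [Nat.le_zero.1 hs, h1]; exact hxy
      by_cases hF : F1 x y 0 (extp v)
      · rw [if_pos hF, if_pos (this.1 hF)]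
      · rw [if_neg hF, if_neg (fun h => hF (this.2 h))]
    rw [ha0, hu0]
    positivity
  have e : pitilde P X₁ X₂ x y z - 1 / N = (m z - avg m) / ∑ z, m z := by
    have : pitilde P X₁ X₂ x y z = m z / ∑ z, m z := by
      rw [← hH]; rfl
    rw [this, avg, ← hNdef, sub_div]
    congr 1
    field_simp
  rw [e, abs_div, abs_of_pos hpos, div_le_iff₀ hpos]
  refine key.trans (le_of_eq ?_)
  rw [avg, ← hNdef]
  ring

/-! ### Part E: the difference of probabilities -/

def FE (y : V) (n : ℕ) (v w : ℕ → V) : Prop :=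
  (∃ s ≤ n, w s = y) ∧ ∃ s ≤ n, (∃ r ≤ s, v r = y) ∧ ∀ r ≤ s, w r ≠ y

lemma FE_dep (y : V) (n : ℕ) : Dep2 n (FE y n) := by
  intro v v' w w' hv hw
  have aux : ∀ v v' w w' : ℕ → V, (∀ i ≤ n, v i = v' i) → (∀ i ≤ n, w i = w' i) →
      FE y n v w → FE y n v' w' := by
    rintro v v' w w' hv hw ⟨⟨s, hs, e⟩, s', hs', ⟨r, hr, er⟩, e2⟩
    refine ⟨⟨s, hs, by rw [← hw s hs]; exact e⟩, s', hs', ⟨r, hr, ?_⟩, fun r hr => ?_⟩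
    · rw [← hv r (by omega)]; exact er
    · rw [← hw r (by omega)]; exact e2 r hr
  exact ⟨aux v v' w w' hv hw, aux v' v w' w (fun i hi => (hv i hi).symm) fun i hi => (hw i hi).symm⟩

lemma hit_lt_iff (Y₁ Y₂ : ℕ → Ω → V) (y : V) (n : ℕ) :
    {ω | hitTime Y₁ y ω < hitTime Y₂ y ω ∧ hitTime Y₂ y ω ≤ (n : ℕ∞)}
      = {ω | FE y n (fun i => Y₁ i ω) (fun i => Y₂ i ω)} := by
  ext ω
  simp only [Set.mem_ofPred_eq, FE]
  rw [hit_le, and_comm]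
  refine and_congr_right fun hn => ?_
  constructor
  · intro h
    obtain ⟨t, ht⟩ := ENat.ne_top_iff_exists.1 (ne_top_of_lt h)
    have h1 := (hit_le Y₂ y ω n).2 hn
    have h2 : (t : ℕ∞) < (n : ℕ∞) := by rw [ht]; exact h.trans_le h1
    have h3 : t < n := by exact_mod_cast h2
    refine ⟨t, h3.le, (hit_le Y₁ y ω t).1 ht.symm.le, (lt_hit Y₂ y ω t).1 ?_⟩
    rw [ht]; exact h
  · rintro ⟨s, _, h1, h2⟩
    exact ((hit_le Y₁ y ω s).2 h1).trans_lt ((lt_hit Y₂ y ω s).2 h2)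

/-- Green function up to time `n` -/
def gr (G : SimpleGraph V) (n : ℕ) (x y : V) : ℝ := ∑ s ∈ Finset.range (n + 1), Kpow G s x y

lemma E_swap {G : SimpleGraph V} {P Q : Measure Ω} [IsProbabilityMeasure P] [IsProbabilityMeasure Q]
    {Y₁ Y₂ : ℕ → Ω → V} {i j : V → ℝ} (hP : IsWalkPair G P Y₁ Y₂ i j)
    (hQ : IsWalkPair G Q Y₁ Y₂ j i) (y : V) (n : ℕ) :
    (P {ω | hitTime Y₂ y ω < hitTime Y₁ y ω ∧ hitTime Y₁ y ω ≤ (n : ℕ∞)}).toReal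
      = (Q {ω | hitTime Y₁ y ω < hitTime Y₂ y ω ∧ hitTime Y₂ y ω ≤ (n : ℕ∞)}).toReal := by
  rw [hit_lt_iff, hit_lt_iff, event_prob hQ n _ (FE_dep y n)]
  have := event_prob hP n (fun v w => FE y n w v)
    (fun v v' w w' hv hw => FE_dep y n w w' v v' hw hv)
  rw [this, Finset.sum_comm]
  refine Finset.sum_congr rfl fun v _ => Finset.sum_congr rfl fun w _ => ?_
  rw [mul_comm]

lemma E_le {G : SimpleGraph V} {P : Measure Ω} [IsProbabilityMeasure P]
    {Y₁ Y₂ : ℕ → Ω → V} {x z : V} (hP : IsWalkPair G P Y₁ Y₂ (delta x) (delta z)) (y : V) (n : ℕ) :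
    (P {ω | hitTime Y₁ y ω < hitTime Y₂ y ω ∧ hitTime Y₂ y ω ≤ (n : ℕ∞)}).toReal
      ≤ gr G n x y * gr G n z y := by
  rw [hit_lt_iff]
  have hsub : {ω | FE y n (fun i => Y₁ i ω) (fun i => Y₂ i ω)}
      ⊆ ⋃ p ∈ Finset.range (n + 1) ×ˢ Finset.range (n + 1), {ω | Y₁ p.1 ω = y ∧ Y₂ p.2 ω = y} := by
    rintro ω ⟨⟨s, hs, e⟩, s', hs', ⟨r, hr, er⟩, e2⟩
    simp only [Set.mem_iUnion, exists_prop]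
    exact ⟨(r, s), by simp; omega, er, e⟩
  have h1 : P.real {ω | FE y n (fun i => Y₁ i ω) (fun i => Y₂ i ω)} ≤ _ :=
    (measureReal_mono hsub (measure_ne_top _ _)).trans (measureReal_biUnion_finset_le _ _)
  refine h1.trans (le_of_eq ?_)
  rw [gr, gr, Finset.sum_mul_sum, ← Finset.sum_product']
  refine Finset.sum_congr rfl fun p hp => ?_
  simp only [Finset.mem_product, Finset.mem_range] at hp
  have := event_prod hP n (fun v => v p.1 = y) (fun v => v p.2 = y)
    (fun v v' h => by simp only [h p.1 (by omega)]) (fun v v' h => by simp only [h p.2 (by omega)])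
  rw [W_point G x p.1 n (by omega), W_point G z p.2 n (by omega)] at this
  exact this

lemma gr_le {G : SimpleGraph V} (hG : Good (KM G) (Tmix G)) (n : ℕ) (x y : V) :
    gr G n x y ≤ green G x y + 5 / 4 * n / (Fintype.card V : ℝ) := by
  have hN := hG.card_pos
  have hk : ∀ s, 0 ≤ Kpow G s x y := fun s => by rw [kpow_eq]; exact hG.pow_nonneg s x y
  unfold gr green
  have h1 : ∑ s ∈ Finset.range (n + 1), Kpow G s x y
      ≤ ∑ s ∈ Finset.range (Tmix G + 1) ∪ Finset.Ico (Tmix G + 1) (n + 1), Kpow G s x y := by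
    refine Finset.sum_le_sum_of_subset_of_nonneg ?_ fun s _ _ => hk s
    intro s hs
    simp only [Finset.mem_union, Finset.mem_range, Finset.mem_Ico] at hs ⊢
    omega
  refine h1.trans ?_
  rw [Finset.sum_union (by
    rw [Finset.disjoint_left]; intro s; simp only [Finset.mem_range, Finset.mem_Ico]; omega)]
  gcongr
  calc ∑ s ∈ Finset.Ico (Tmix G + 1) (n + 1), Kpow G s x y
      ≤ ∑ s ∈ Finset.Ico (Tmix G + 1) (n + 1), 5 / 4 / (Fintype.card V : ℝ) := by
        refine Finset.sum_le_sum fun s hs => ?_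
        rw [Finset.mem_Ico] at hs
        rw [kpow_eq]
        exact hG.pow_le (by omega) x y
    _ = ((n + 1 - (Tmix G + 1) : ℕ) : ℝ) * (5 / 4 / (Fintype.card V : ℝ)) := by
        rw [Finset.sum_const, Nat.card_Ico, nsmul_eq_mul]
    _ ≤ (n : ℝ) * (5 / 4 / (Fintype.card V : ℝ)) := by
        gcongr
        omega
    _ = _ := by ring
/-! ### Part F: summation -/

lemma y_sum (a : V → ℝ) (k : V → V → ℝ) (γ d A R : ℝ) (ha : ∀ x, 0 ≤ a x) (hk : ∀ x z, 0 ≤ k x z)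
    (hγ : 0 ≤ γ) (hd : 0 ≤ d) (haA : ∑ x, a x ≤ A) (haR : ∑ x, a x ^ 2 ≤ R)
    (hkA : ∀ x, ∑ z, k x z ≤ A) (hkR : ∀ x, ∑ z, k x z ^ 2 ≤ R) (hks : ∀ x z, k x z = k z x)
    (B : ℝ) (hB : B = A + γ * (Fintype.card V : ℝ)) :
    ∑ x, ∑ z, (a x + γ) * (a z + γ) * (k z x + a z + d)
      ≤ d * B ^ 2 + 2 * B * R + 3 * γ * A * B := by
  have hN : (0 : ℝ) ≤ (Fintype.card V : ℝ) := by positivity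
  have hA : 0 ≤ A := (Finset.sum_nonneg fun x _ => ha x).trans haA
  have hR : 0 ≤ R := (Finset.sum_nonneg fun x _ => sq_nonneg (a x)).trans haR
  have hAB : A ≤ B := by rw [hB]; nlinarith
  have hsB : ∑ x, (a x + γ) ≤ B := by
    rw [Finset.sum_add_distrib, Finset.sum_const, Finset.card_univ, nsmul_eq_mul, hB]; linarith
  have hs0 : 0 ≤ ∑ x, (a x + γ) := Finset.sum_nonneg fun x _ => add_nonneg (ha x) hγ
  have hB0 : 0 ≤ B := hs0.trans hsB
  have pt : ∀ x z, (a x + γ) * (a z + γ) * (k z x + a z + d)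
      ≤ (d * ((a x + γ) * (a z + γ)) + (a x + γ) * (a z ^ 2 + γ * a z))
        + (1 / 2 * (a x * a z ^ 2) + 1 / 2 * (a x * k x z ^ 2))
        + (γ * (a x * k x z) + γ * ((a z + γ) * k z x)) := by
    intro x z
    rw [hks x z]
    nlinarith [mul_nonneg (ha x) (sq_nonneg (a z - k z x))]
  have s1 : ∑ x, ∑ z, d * ((a x + γ) * (a z + γ)) ≤ d * B ^ 2 := by
    simp_rw [← Finset.mul_sum]
    rw [← Finset.sum_mul]
    refine mul_le_mul_of_nonneg_left ?_ hd
    rw [sq]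
    exact mul_le_mul hsB hsB hs0 hB0
  have s2 : ∑ x, ∑ z, (a x + γ) * (a z ^ 2 + γ * a z) ≤ B * (R + γ * A) := by
    simp_rw [← Finset.mul_sum]
    rw [← Finset.sum_mul]
    refine mul_le_mul hsB ?_ (Finset.sum_nonneg fun z _ => by have := ha z; positivity) hB0
    rw [Finset.sum_add_distrib, ← Finset.mul_sum]
    exact add_le_add haR (mul_le_mul_of_nonneg_left haA hγ)
  have s3 : ∑ x, ∑ z, 1 / 2 * (a x * a z ^ 2) ≤ 1 / 2 * (A * R) := by
    simp_rw [← Finset.mul_sum]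
    rw [← Finset.sum_mul]
    refine mul_le_mul_of_nonneg_left ?_ (by norm_num)
    exact mul_le_mul haA haR (Finset.sum_nonneg fun z _ => sq_nonneg _) hA
  have s4 : ∑ x, ∑ z, 1 / 2 * (a x * k x z ^ 2) ≤ 1 / 2 * (A * R) := by
    simp_rw [← Finset.mul_sum]
    refine mul_le_mul_of_nonneg_left ?_ (by norm_num)
    calc ∑ x, a x * ∑ z, k x z ^ 2 ≤ ∑ x, a x * R :=
          Finset.sum_le_sum fun x _ => mul_le_mul_of_nonneg_left (hkR x) (ha x)
      _ = (∑ x, a x) * R := by rw [Finset.sum_mul]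
      _ ≤ _ := mul_le_mul_of_nonneg_right haA hR
  have s5 : ∑ x, ∑ z, γ * (a x * k x z) ≤ γ * (A * A) := by
    simp_rw [← Finset.mul_sum]
    refine mul_le_mul_of_nonneg_left ?_ hγ
    calc ∑ x, a x * ∑ z, k x z ≤ ∑ x, a x * A :=
          Finset.sum_le_sum fun x _ => mul_le_mul_of_nonneg_left (hkA x) (ha x)
      _ = (∑ x, a x) * A := by rw [Finset.sum_mul]
      _ ≤ _ := mul_le_mul_of_nonneg_right haA hA
  have s6 : ∑ x, ∑ z, γ * ((a z + γ) * k z x) ≤ γ * (B * A) := by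
    rw [Finset.sum_comm]
    simp_rw [← Finset.mul_sum]
    refine mul_le_mul_of_nonneg_left ?_ hγ
    calc ∑ z, (a z + γ) * ∑ x, k z x ≤ ∑ z, (a z + γ) * A :=
          Finset.sum_le_sum fun x _ => mul_le_mul_of_nonneg_left (hkA x) (add_nonneg (ha x) hγ)
      _ = (∑ z, (a z + γ)) * A := by rw [Finset.sum_mul]
      _ ≤ _ := mul_le_mul_of_nonneg_right hsB hA
  have tot := Finset.sum_le_sum fun x (_ : x ∈ Finset.univ) =>
    Finset.sum_le_sum fun z (_ : z ∈ Finset.univ) => pt x z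
  simp only [Finset.sum_add_distrib] at tot
  have t1 : A * R ≤ B * R := mul_le_mul_of_nonneg_right hAB hR
  have t2 : γ * (A * A) ≤ γ * (A * B) :=
    mul_le_mul_of_nonneg_left (mul_le_mul_of_nonneg_left hAB hA) hγ
  nlinarith

lemma abstract_sum (D pt : V → V → V → ℝ) (h g : V → V → ℝ) (γ d A R : ℝ)
    (hNp : 0 < (Fintype.card V : ℝ))
    (hD : ∀ x y z, D x y z = - D z y x) (hDb : ∀ x y z, |D x y z| ≤ h x y * h z y)
    (h0 : ∀ x y, 0 ≤ h x y) (hg : ∀ x y, h x y ≤ g x y + γ)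
    (hpy : ∀ x y, pt x y y = 0)
    (hpt : ∀ x y z, x ≠ y → |pt x y z - 1 / (Fintype.card V : ℝ)|
      ≤ 5 / (Fintype.card V : ℝ) * (g z x + g z y + d))
    (hγ : 0 ≤ γ) (hd : 0 ≤ d) (gn : ∀ x y, 0 ≤ g x y) (gs : ∀ x y, g x y = g y x)
    (gA : ∀ x, ∑ y, g x y ≤ A) (gR : ∀ x, ∑ y ∈ Finset.univ.erase x, g x y ^ 2 ≤ R)
    (B : ℝ) (hB : B = A + γ * (Fintype.card V : ℝ)) :
    |∑ x, ∑ y ∈ Finset.univ.erase x, ∑ z, D x y z * pt x y z|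
      ≤ 5 * (d * B ^ 2 + 2 * B * R + 3 * γ * A * B) := by
  set N : ℝ := (Fintype.card V : ℝ) with hNdef
  set k : V → V → ℝ := fun x y => if x = y then 0 else g x y with hk
  have kn : ∀ x y, 0 ≤ k x y := fun x y => by
    simp only [hk]; split_ifs
    · exact le_rfl
    · exact gn x y
  have ks : ∀ x y, k x y = k y x := fun x y => by
    simp only [hk]
    by_cases e : x = y
    · rw [if_pos e, if_pos e.symm]
    · rw [if_neg e, if_neg (fun h => e h.symm), gs]
  have kA : ∀ x, ∑ y, k x y ≤ A := fun x => by
    refine (Finset.sum_le_sum fun y _ => ?_).trans (gA x)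
    simp only [hk]; split_ifs
    · exact gn x y
    · exact le_rfl
  have kR : ∀ x, ∑ y, k x y ^ 2 ≤ R := fun x => by
    refine le_trans (le_of_eq ?_) (gR x)
    rw [← Finset.add_sum_erase _ _ (Finset.mem_univ x)]
    simp only [hk, if_true]
    rw [zero_pow (by norm_num), zero_add]
    refine Finset.sum_congr rfl fun y hy => ?_
    rw [if_neg (Finset.ne_of_mem_erase hy).symm]
  set f : V → V → V → ℝ := fun x y z => if x ≠ y ∧ z ≠ y then D x y z else 0 with hf
  have hzero : ∑ y, ∑ x, ∑ z, f x y z = 0 := by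
    refine Finset.sum_eq_zero fun y _ => ?_
    have e1 : ∑ x, ∑ z, f x y z = ∑ x, ∑ z, - f x y z := by
      conv_lhs => rw [Finset.sum_comm]
      refine Finset.sum_congr rfl fun x _ => Finset.sum_congr rfl fun z _ => ?_
      simp only [hf]
      by_cases c : x ≠ y ∧ z ≠ y
      · rw [if_pos c, if_pos c.symm, hD]
      · rw [if_neg c, if_neg (fun h => c h.symm), neg_zero]
    simp only [Finset.sum_neg_distrib] at e1
    linarith
  have hS : ∑ x, ∑ y ∈ Finset.univ.erase x, ∑ z, D x y z * pt x y z
      = ∑ y, ∑ x, ∑ z, f x y z * (pt x y z - 1 / N) := by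
    have e1 : ∑ y, ∑ x, ∑ z, f x y z * (pt x y z - 1 / N)
        = ∑ y, ∑ x, ∑ z, f x y z * pt x y z := by
      simp_rw [mul_sub, Finset.sum_sub_distrib, ← Finset.sum_mul]
      rw [hzero]; ring
    rw [e1, Finset.sum_comm (s := (Finset.univ : Finset V)) (t := (Finset.univ : Finset V))]
    refine Finset.sum_congr rfl fun x _ => ?_
    rw [← Finset.add_sum_erase (Finset.univ : Finset V) (fun y => ∑ z, f x y z * pt x y z)
      (Finset.mem_univ x)]
    have : ∑ z, f x x z * pt x x z = 0 := Finset.sum_eq_zero fun z _ => by simp [hf]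
    rw [this, zero_add]
    refine Finset.sum_congr rfl fun y hy => Finset.sum_congr rfl fun z _ => ?_
    have hxy : x ≠ y := (Finset.ne_of_mem_erase hy).symm
    by_cases hz : z = y
    · rw [hz, hpy, mul_zero, mul_zero]
    · simp only [hf]; rw [if_pos ⟨hxy, hz⟩]
  have hpoint : ∀ x y z, |f x y z * (pt x y z - 1 / N)|
      ≤ 5 / N * ((k x y + γ) * (k z y + γ) * (k z x + k z y + d)) := by
    intro x y z
    have p1 := kn x y
    have p2 := kn z y
    have p3 := kn z x
    have hR0 : 0 ≤ 5 / N * ((k x y + γ) * (k z y + γ) * (k z x + k z y + d)) := by positivity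
    by_cases c : x ≠ y ∧ z ≠ y
    · by_cases hzx : z = x
      · have : D x y z = 0 := by
          rw [hzx]; have := hD x y x; linarith
        simp only [hf]; rw [if_pos c, this]; simpa using hR0
      · have e1 : f x y z = D x y z := by simp only [hf]; rw [if_pos c]
        have k1 : k x y = g x y := by simp only [hk]; rw [if_neg c.1]
        have k2 : k z y = g z y := by simp only [hk]; rw [if_neg c.2]
        have k3 : k z x = g z x := by simp only [hk]; rw [if_neg hzx]
        rw [e1, abs_mul, k1, k2, k3]
        have q := hpt x y z c.1
        have q2 : |D x y z| ≤ (g x y + γ) * (g z y + γ) :=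
          (hDb x y z).trans (mul_le_mul (hg x y) (hg z y) (h0 z y) (by rw [← k1]; positivity))
        calc _ ≤ ((g x y + γ) * (g z y + γ)) * (5 / N * (g z x + g z y + d)) :=
              mul_le_mul q2 q (abs_nonneg _) (by rw [← k1, ← k2]; positivity)
          _ = _ := by ring
    · have : f x y z = 0 := by simp only [hf]; rw [if_neg c]
      rw [this, zero_mul, abs_zero]; exact hR0
  rw [hS]
  have hy : ∀ y, ∑ x, ∑ z, (k x y + γ) * (k z y + γ) * (k z x + k z y + d)
      ≤ d * B ^ 2 + 2 * B * R + 3 * γ * A * B := fun y =>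
    y_sum (fun x => k x y) k γ d A R (fun x => kn x y) kn hγ hd
      (by simp_rw [fun x => ks x y]; exact kA y) (by simp_rw [fun x => ks x y]; exact kR y)
      kA kR ks B hB
  calc |∑ y, ∑ x, ∑ z, f x y z * (pt x y z - 1 / N)|
      ≤ ∑ y, ∑ x, ∑ z, |f x y z * (pt x y z - 1 / N)| := by
        refine (Finset.abs_sum_le_sum_abs _ _).trans (Finset.sum_le_sum fun y _ => ?_)
        refine (Finset.abs_sum_le_sum_abs _ _).trans (Finset.sum_le_sum fun x _ => ?_)
        exact Finset.abs_sum_le_sum_abs _ _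
    _ ≤ ∑ y, ∑ x, ∑ z, 5 / N * ((k x y + γ) * (k z y + γ) * (k z x + k z y + d)) :=
        Finset.sum_le_sum fun y _ => Finset.sum_le_sum fun x _ => Finset.sum_le_sum fun z _ =>
          hpoint x y z
    _ = ∑ y, 5 / N * ∑ x, ∑ z, (k x y + γ) * (k z y + γ) * (k z x + k z y + d) := by
        simp_rw [← Finset.mul_sum]
    _ ≤ ∑ _y : V, 5 / N * (d * B ^ 2 + 2 * B * R + 3 * γ * A * B) :=
        Finset.sum_le_sum fun y _ => mul_le_mul_of_nonneg_left (hy y) (by positivity)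
    _ = 5 * (d * B ^ 2 + 2 * B * R + 3 * γ * A * B) := by
        rw [Finset.sum_const, Finset.card_univ, nsmul_eq_mul, ← hNdef]
        field_simp

lemma final_bound {Ω' : Type*} [MeasurableSpace Ω'] (G : SimpleGraph V) (hvt : IsVertexTransitive G)
    (hT : 1 ≤ Tmix G) (hN : 3 ≤ Fintype.card V)
    (hL : 1 ≤ Real.log (Fintype.card V))
    (hd : 2 * (Tmix G : ℝ) / (Fintype.card V : ℝ) ≤ 3 / 20)
    (P : Measure Ω) [IsProbabilityMeasure P] (X₁ X₂ : ℕ → Ω → V)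
    (hX : IsWalkPair G P X₁ X₂ (uinit V) (uinit V))
    (Q : V → V → Measure Ω') (hQ : ∀ x z, IsProbabilityMeasure (Q x z))
    (Y₁ Y₂ : ℕ → Ω' → V) (hY : ∀ x z, IsWalkPair G (Q x z) Y₁ Y₂ (delta x) (delta z))
    (c₀ : ℝ) (hc : 0 ≤ c₀) (ε : ℝ)
    (hε : ∀ x : V, ∑ y ∈ Finset.univ.erase x, (green G x y) ^ 2
      ≤ ε * (Tmix G : ℝ) / Real.log (Fintype.card V)) :
    |(∑ x : V, ∑ y ∈ Finset.univ.erase x, ∑ z : V,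
        ((Q x z {ω | hitTime Y₁ y ω < hitTime Y₂ y ω
              ∧ hitTime Y₂ y ω ≤ (gammaTime G c₀ : ℕ∞)}).toReal
          - (Q x z {ω | hitTime Y₂ y ω < hitTime Y₁ y ω
              ∧ hitTime Y₁ y ω ≤ (gammaTime G c₀ : ℕ∞)}).toReal)
        * pitilde P X₁ X₂ x y z) / (Tmix G : ℝ) ^ 2|
      ≤ 10 * (2 + 2 * c₀) * ε + 40 * (2 + 2 * c₀) ^ 2 *
        ((Tmix G : ℝ) * (Real.log (Fintype.card V)) ^ 2 / (Fintype.card V : ℝ)) := by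
  have hG := good_K G hvt hT (by omega)
  have hNp := hG.card_pos
  set n := gammaTime G c₀ with hn
  have hTr : (1 : ℝ) ≤ (Tmix G : ℝ) := by exact_mod_cast hT
  set T : ℝ := (Tmix G : ℝ) with hTdef
  set L : ℝ := Real.log (Fintype.card V) with hLdef
  set N : ℝ := (Fintype.card V : ℝ) with hNdef
  have hnle : (n : ℝ) ≤ c₀ * T * L := Nat.floor_le (by positivity)
  have main := abstract_sum (V := V)
    (fun x y z => (Q x z {ω | hitTime Y₁ y ω < hitTime Y₂ y ω ∧ hitTime Y₂ y ω ≤ (n : ℕ∞)}).toReal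
      - (Q x z {ω | hitTime Y₂ y ω < hitTime Y₁ y ω ∧ hitTime Y₁ y ω ≤ (n : ℕ∞)}).toReal)
    (fun x y z => pitilde P X₁ X₂ x y z) (gr G n) (green G) (5 / 4 * n / N) (2 * T / N) (T + 1)
    (ε * T / L) hNp
    (fun x y z => by
      have := hQ x z
      have := hQ z x
      rw [E_swap (hY x z) (hY z x) y n, E_swap (hY z x) (hY x z) y n]; ring)
    (fun x y z => by
      have := hQ x z
      have := hQ z x
      have a1 := E_le (hY x z) y n
      have a2 := E_le (hY z x) y n
      rw [E_swap (hY x z) (hY z x) y n]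
      rw [mul_comm] at a2
      have b1 : 0 ≤ (Q x z {ω | hitTime Y₁ y ω < hitTime Y₂ y ω ∧ hitTime Y₂ y ω ≤ (n : ℕ∞)}).toReal :=
        ENNReal.toReal_nonneg
      have b2 : 0 ≤ (Q z x {ω | hitTime Y₁ y ω < hitTime Y₂ y ω ∧ hitTime Y₂ y ω ≤ (n : ℕ∞)}).toReal :=
        ENNReal.toReal_nonneg
      rw [abs_le]
      constructor <;> linarith)
    (fun x y => Finset.sum_nonneg fun s _ => by rw [kpow_eq]; exact hG.pow_nonneg s x y)
    (fun x y => gr_le hG n x y)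
    (fun x y => pitilde_y P X₁ X₂ x y)
    (fun x y z hxy => pitilde_bound hvt hX hG hN x y hxy _ le_rfl hd z)
    (by positivity) (by positivity)
    (fun x y => by rw [green_eq]; exact Finset.sum_nonneg fun s _ => hG.pow_nonneg s x y)
    (fun x y => by
      rw [green_eq, green_eq]; exact Finset.sum_congr rfl fun s _ => hG.pow_symm s x y)
    (fun x => by
      simp_rw [green_eq]
      rw [Finset.sum_comm]
      simp_rw [hG.pow_row]
      simp [hTdef])
    hε _ rfl
  rw [abs_div, abs_of_pos (by positivity : 0 < T ^ 2), div_le_iff₀ (by positivity)]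
  refine main.trans ?_
  have hBe : T + 1 + 5 / 4 * n / N * N = T + 1 + 5 / 4 * n := by field_simp
  rw [← hNdef, hBe]
  set B := T + 1 + 5 / 4 * (n : ℝ) with hB
  have hn0 : (0 : ℝ) ≤ n := by positivity
  have hTL : T ≤ T * L := by nlinarith
  have hBle : B ≤ (2 + 2 * c₀) * (T * L) := by
    have : 0 ≤ c₀ * T * L := by positivity
    nlinarith
  have hB0 : 0 ≤ B := by positivity
  have hR0 : 0 ≤ ε * T / L := by
    have : Nonempty V := Fintype.card_pos_iff.1 (by omega)
    obtain ⟨x⟩ := this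
    exact (Finset.sum_nonneg fun y _ => sq_nonneg _).trans (hε x)
  have e1 : B * (ε * T / L) ≤ (2 + 2 * c₀) * ε * T ^ 2 := by
    calc B * (ε * T / L) ≤ (2 + 2 * c₀) * (T * L) * (ε * T / L) :=
          mul_le_mul_of_nonneg_right hBle hR0
      _ = _ := by field_simp
  have e2 : B ^ 2 ≤ (2 + 2 * c₀) ^ 2 * (T * L) ^ 2 := by
    rw [← mul_pow]; exact pow_le_pow_left₀ hB0 hBle 2
  have e3 : 3 * (5 / 4 * n / N) * (T + 1) * B ≤ 6 * T / N * B ^ 2 := by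
    have f1 : 5 / 4 * (n : ℝ) ≤ B := by linarith
    calc 3 * (5 / 4 * n / N) * (T + 1) * B = 3 / N * ((5 / 4 * n) * (T + 1)) * B := by ring
      _ ≤ 3 / N * (B * (2 * T)) * B := by
        gcongr
        linarith
      _ = _ := by ring
  have e4 : 8 * T / N * B ^ 2 ≤ 8 * T / N * ((2 + 2 * c₀) ^ 2 * (T * L) ^ 2) :=
    mul_le_mul_of_nonneg_left e2 (by positivity)
  have e5 : 2 * T / N * B ^ 2 + 6 * T / N * B ^ 2 = 8 * T / N * B ^ 2 := by ring
  have e6 : 8 * T / N * ((2 + 2 * c₀) ^ 2 * (T * L) ^ 2)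
      = 8 * (2 + 2 * c₀) ^ 2 * (T * L ^ 2 / N) * T ^ 2 := by ring
  nlinarith

/-- Lemma 16. Under Assumption 1, with
`Γ_n = c₀ T_mix log |V_n|` for a sufficiently large universal constant `c₀`,
`∑_{x≠y,z} (P_{x,z}[τ₁(y) < τ₂(y) ≤ Γ_n] - P_{x,z}[τ₂(y) < τ₁(y) ≤ Γ_n]) π̃(z;x,y)
  = o(T_mix²)` as `n → ∞`. -/
theorem early_term_negligible
    (V : ℕ → Type) [∀ n, Fintype (V n)] (G : ∀ n, SimpleGraph (V n))
    (hA : Assumption1 V G)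
    (Ω : ℕ → Type) [∀ n, MeasurableSpace (Ω n)]
    (P : ∀ n, Measure (Ω n)) (hP : ∀ n, IsProbabilityMeasure (P n))
    (X₁ X₂ : ∀ n, ℕ → Ω n → V n)
    (hsetup : ∀ n, IsWalkPair (G n) (P n) (X₁ n) (X₂ n) (uinit (V n)) (uinit (V n)))
    (Ωd : ℕ → Type) [∀ n, MeasurableSpace (Ωd n)]
    (Pd : ∀ n, V n → V n → Measure (Ωd n))
    (hPd : ∀ n (x z : V n), IsProbabilityMeasure (Pd n x z))
    (Y₁ Y₂ : ∀ n, ℕ → Ωd n → V n)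
    (hd : ∀ n (x z : V n), IsWalkPair (G n) (Pd n x z) (Y₁ n) (Y₂ n) (delta x) (delta z)) :
    ∃ c₀bar : ℝ, ∀ c₀ : ℝ, c₀bar ≤ c₀ →
      Tendsto (fun n =>
          (∑ x : V n, ∑ y ∈ Finset.univ.erase x, ∑ z : V n,
              ((Pd n x z {ω | hitTime (Y₁ n) y ω < hitTime (Y₂ n) y ω
                    ∧ hitTime (Y₂ n) y ω ≤ (gammaTime (G n) c₀ : ℕ∞)}).toReal
                - (Pd n x z {ω | hitTime (Y₂ n) y ω < hitTime (Y₁ n) y ω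
                    ∧ hitTime (Y₁ n) y ω ≤ (gammaTime (G n) c₀ : ℕ∞)}).toReal)
              * pitilde (P n) (X₁ n) (X₂ n) x y z)
            / (Tmix (G n) : ℝ) ^ 2)
        atTop (nhds 0) := by
  refine ⟨0, fun c₀ hc => ?_⟩
  obtain ⟨ε, hε0, hε⟩ := hA.green_sq_small
  have hcr : Tendsto (fun n => (Fintype.card (V n) : ℝ)) atTop atTop :=
    tendsto_natCast_atTop_atTop.comp hA.card_top
  have hlog : Tendsto (fun n => Real.log (Fintype.card (V n))) atTop atTop :=
    Real.tendsto_log_atTop.comp hcr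
  have hlim : Tendsto (fun n => 10 * (2 + 2 * c₀) * ε n + 40 * (2 + 2 * c₀) ^ 2 *
      ((Tmix (G n) : ℝ) * (Real.log (Fintype.card (V n))) ^ 2 / (Fintype.card (V n) : ℝ)))
      atTop (nhds 0) := by
    have := (hε0.const_mul (10 * (2 + 2 * c₀))).add
      (hA.tmix_small.const_mul (40 * (2 + 2 * c₀) ^ 2))
    simpa using this
  refine squeeze_zero_norm' ?_ hlim
  filter_upwards [hA.card_top.eventually_ge_atTop 3, hA.tmix_top.eventually_ge_atTop 1,
    hlog.eventually_ge_atTop 1,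
    hA.tmix_small.eventually (eventually_le_nhds (show (0 : ℝ) < 3 / 40 by norm_num))]
    with n h1 h2 h3 h4
  have hNp : (0 : ℝ) < (Fintype.card (V n) : ℝ) := by
    have : 0 < Fintype.card (V n) := by omega
    exact_mod_cast this
  have hdd : 2 * (Tmix (G n) : ℝ) / (Fintype.card (V n) : ℝ) ≤ 3 / 20 := by
    have hT0 : (0 : ℝ) ≤ (Tmix (G n) : ℝ) := by positivity
    have hl : (1 : ℝ) ≤ (Real.log (Fintype.card (V n))) ^ 2 := one_le_pow₀ h3
    rw [div_le_iff₀ hNp] at h4 ⊢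
    nlinarith
  rw [Real.norm_eq_abs]
  have := hP n
  exact final_bound (G n) (hA.vt n) h2 h1 h3 hdd (P n) (X₁ n) (X₂ n) (hsetup n) (Pd n) (hPd n)
    (Y₁ n) (Y₂ n) (hd n) c₀ hc (ε n) (hε n)

end RWPaint
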